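/- Let $r\ge 3$ be an integer with $r\mid n$, let $\varepsilon>0$ be a sufficiently small constant, let $\rho\ge 1$ be a fixed integer, and set $d^*=\lceil\varepsilon^2\log n\rceil$ and $m'=\lfloor\varepsilon n\log n/(r\rho)\rfloor$. Let $\Gamma$ be the union of an instance of $\hat H_{n,d^*}$ and an independent instance of $H_{n,m'}$. Then, as $n\to\infty$ along multiples of $r$, the probability that $\Gamma$ contains a perfect matching tends to $1$. -/

import Mathlib

open scoped Classical

/-- The set of all possible edges of an `r`-uniform hypergraph on vertex set `Fin n`:
all `r`-element subsets of `Fin n`. -/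
def allEdges (r n : ℕ) : Finset (Finset (Fin n)) :=
  Finset.univ.powersetCard r

/-- The probability that a uniformly random element of the finite set `S`
satisfies the property `P`. -/
noncomputable def pr {α : Type*} (S : Finset α) (P : α → Prop) : ℝ :=
  ((S.filter P).card : ℝ) / (S.card : ℝ)

/-- The outcome space of the random hypergraph `Ĥ_{n,d}`: every vertex `v : Fin n`
picks (uniformly, independently, with replacement) `d` edges containing `v`. -/
abbrev Picks (r n d : ℕ) :=
  ∀ v : Fin n, Fin d → {e : Finset (Fin n) // e.card = r ∧ v ∈ e}

/-- The edge set of the hypergraph `Ĥ_{n,d}` determined by an outcome `a`: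
the union of all picked edges. -/
def edgesOf {r n d : ℕ} (a : Picks r n d) : Finset (Finset (Fin n)) :=
  Finset.univ.biUnion fun v => Finset.univ.image fun j => (a v j).1

/-- `H` (an `r`-uniform hypergraph on `Fin n`, given as a set of `r`-element subsets)
contains a perfect matching: a set of `n / r` pairwise disjoint edges covering all of
`Fin n`. -/
def HasPerfectMatching (r n : ℕ) (H : Finset (Finset (Fin n))) : Prop :=
  ∃ M : Finset (Finset (Fin n)), M ⊆ H ∧ M.card = n / r ∧
    (∀ e ∈ M, ∀ f ∈ M, e ≠ f → Disjoint e f) ∧ M.biUnion id = Finset.univ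


lemma choose_ratio (a b k : ℕ) (h : a ≤ b) : a.choose k * b ^ k ≤ b.choose k * a ^ k := by
  induction k with
  | zero => simp
  | succ k ih =>
    have h1 := Nat.choose_succ_right_eq a k
    have h2 := Nat.choose_succ_right_eq b k
    have h3 : (a - k) * b ≤ (b - k) * a := by
      rw [Nat.sub_mul, Nat.sub_mul, Nat.mul_comm b a]
      exact Nat.sub_le_sub_left (Nat.mul_le_mul_left k h) _
    have : (a.choose (k+1) * b ^ (k+1)) * (k+1) ≤ (b.choose (k+1) * a ^ (k+1)) * (k+1) := by
      calc (a.choose (k+1) * b ^ (k+1)) * (k+1) = (a.choose (k+1) * (k+1)) * (b^k * b) := by ring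
        _ = (a.choose k * b^k) * ((a-k) * b) := by rw [h1]; ring
        _ ≤ (b.choose k * a^k) * ((b-k) * a) := Nat.mul_le_mul ih h3
        _ = (b.choose (k+1) * (k+1)) * (a^k * a) := by rw [h2]; ring
        _ = _ := by ring
    exact Nat.le_of_mul_le_mul_right this (Nat.succ_pos k)

lemma choose_add_le (N w t : ℕ) : N.choose (w+t) * w ^ t ≤ N.choose w * N ^ t := by
  induction t with
  | zero => simp
  | succ t ih =>
    have h1 := Nat.choose_succ_right_eq N (w+t)
    calc N.choose (w+(t+1)) * w ^ (t+1) = N.choose (w+t+1) * w * w^t := by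
            rw [← add_assoc]; ring
      _ ≤ N.choose (w+t+1) * (w+t+1) * w^t := by gcongr; omega
      _ = (N.choose (w+t) * w^t) * (N - (w+t)) := by rw [h1]; ring
      _ ≤ (N.choose w * N^t) * N := Nat.mul_le_mul ih (Nat.sub_le _ _)
      _ = _ := by ring

lemma split_count {α : Type*} [DecidableEq α] (X : Finset α) (a b : ℕ) (Q : Finset α → Prop) :
    ((X.powersetCard (a+b)).filter Q).card * (a+b).choose a =
      ∑ W ∈ X.powersetCard a, (((X \ W).powersetCard b).filter (fun C => Q (W ∪ C))).card := by
  rw [← Finset.card_sigma]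
  have : ((X.powersetCard (a+b)).filter Q).card * (a+b).choose a =
      (((X.powersetCard (a+b)).filter Q).sigma (fun C => C.powersetCard a)).card := by
    rw [Finset.card_sigma, Finset.sum_const_nat (m := (a+b).choose a)]
    intro C hC
    simp only [Finset.mem_filter, Finset.mem_powersetCard] at hC
    rw [Finset.card_powersetCard, hC.1.2]
  rw [this]
  refine Finset.card_nbij' (fun p => ⟨p.2, p.1 \ p.2⟩) (fun p => ⟨p.1 ∪ p.2, p.1⟩) ?_ ?_ ?_ ?_
  · rintro ⟨C, W⟩ h
    simp only [Finset.coe_sigma, Set.mem_sigma_iff, Finset.mem_coe, Finset.mem_filter, Finset.mem_powersetCard] at h ⊢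
    obtain ⟨⟨⟨h1, h2⟩, h3⟩, h4, h5⟩ := h
    refine ⟨⟨h4.trans h1, h5⟩, ⟨Finset.sdiff_subset_sdiff h1 le_rfl, ?_⟩, ?_⟩
    · rw [Finset.card_sdiff_of_subset h4]; omega
    · rwa [Finset.union_sdiff_of_subset h4]
  · rintro ⟨W, C⟩ h
    simp only [Finset.coe_sigma, Set.mem_sigma_iff, Finset.mem_coe, Finset.mem_filter, Finset.mem_powersetCard] at h ⊢
    obtain ⟨⟨h1, h2⟩, ⟨h3, h4⟩, h5⟩ := h
    have hd : Disjoint W C := (Finset.disjoint_of_subset_left h3 Finset.sdiff_disjoint).symm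
    refine ⟨⟨⟨Finset.union_subset h1 (h3.trans Finset.sdiff_subset), ?_⟩, h5⟩, Finset.subset_union_left, h2⟩
    rw [Finset.card_union_of_disjoint hd, h2, h4]
  · rintro ⟨C, W⟩ h
    simp only [Finset.coe_sigma, Set.mem_sigma_iff, Finset.mem_coe, Finset.mem_filter, Finset.mem_powersetCard] at h ⊢
    simp [Finset.union_sdiff_of_subset h.2.1]
  · rintro ⟨W, C⟩ h
    simp only [Finset.coe_sigma, Set.mem_sigma_iff, Finset.mem_coe, Finset.mem_filter, Finset.mem_powersetCard] at h ⊢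
    have hd : Disjoint W C := (Finset.disjoint_of_subset_left h.2.1.1 Finset.sdiff_disjoint).symm
    simp [Finset.union_sdiff_cancel_left hd]

lemma frag_exists {α ι : Type*} [DecidableEq α] (I : Finset ι) (S : ι → Finset α) (W : Finset α) (i : ι) (hi : i ∈ I) :
    ∃ T : Finset α, T ⊆ S i ∧ Disjoint W T ∧ (∃ j ∈ I, T = S j \ W) ∧
      ∀ j ∈ I, S j ⊆ W ∪ T → T ⊆ S j := by
  obtain ⟨j, hj, hmin⟩ := Finset.exists_min_image (I.filter (fun j => S j ⊆ W ∪ S i))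
    (fun j => (S j \ W).card) ⟨i, by simp [hi]⟩
  rw [Finset.mem_filter] at hj
  have hsub : S j \ W ⊆ S i := by
    intro a ha
    rw [Finset.mem_sdiff] at ha
    rcases Finset.mem_union.1 (hj.2 ha.1) with h | h
    · exact absurd h ha.2
    · exact h
  refine ⟨S j \ W, hsub, Finset.disjoint_sdiff, ⟨j, hj.1, rfl⟩, ?_⟩
  intro l hl hlW
  have h1 : S l \ W ⊆ S j \ W := by
    intro a ha
    rw [Finset.mem_sdiff] at ha
    rcases Finset.mem_union.1 (hlW ha.1) with h | h
    · exact absurd h ha.2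
    · exact h
  have h2 := hmin l (by
    rw [Finset.mem_filter]
    exact ⟨hl, hlW.trans (Finset.union_subset_union_right hsub)⟩)
  have h3 := Finset.eq_of_subset_of_card_le h1 h2
  rw [← h3]; exact Finset.sdiff_subset

lemma frag_count {α ι : Type*} [DecidableEq α] (I : Finset ι) (S : ι → Finset α) (μ : ι → ℝ)
    (X : Finset α) (k w t : ℕ) (q : ℝ) (hq : 0 ≤ q)
    (hSX : ∀ i ∈ I, S i ⊆ X) (hk : ∀ i ∈ I, (S i).card ≤ k)
    (hμ : ∀ i ∈ I, 0 ≤ μ i)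
    (hs : ∀ A : Finset α, ∑ i ∈ I.filter (fun i => A ⊆ S i), μ i ≤ q ^ A.card)
    (T : Finset α → ι → Finset α)
    (hT : ∀ W, ∀ i ∈ I, T W i ⊆ S i ∧ Disjoint W (T W i) ∧ (∃ j ∈ I, T W i = S j \ W) ∧
      ∀ j ∈ I, S j ⊆ W ∪ T W i → T W i ⊆ S j) :
    ∑ W ∈ X.powersetCard w, ∑ i ∈ I.filter (fun i => (T W i).card = t), μ i ≤
      (X.card.choose (w+t) * k.choose t : ℕ) * q ^ t := by
  set P : Finset (Finset α) → Finset (Sigma fun _ : Finset α => Finset α) := fun Ws =>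
    Ws.sigma (fun W => (I.filter (fun i => (T W i).card = t)).image (T W)) with hP
  have h1 : ∑ W ∈ X.powersetCard w, ∑ i ∈ I.filter (fun i => (T W i).card = t), μ i ≤
      ((P (X.powersetCard w)).card : ℝ) * q ^ t := by
    rw [hP, Finset.card_sigma]
    push_cast
    rw [Finset.sum_mul]
    apply Finset.sum_le_sum
    intro W hW
    rw [← Finset.sum_fiberwise_of_maps_to (s := I.filter (fun i => (T W i).card = t))
      (t := (I.filter (fun i => (T W i).card = t)).image (T W)) (g := T W)
      (fun i hi => Finset.mem_image_of_mem _ hi)]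
    rw [← nsmul_eq_mul]
    apply Finset.sum_le_card_nsmul
    intro A hA
    obtain ⟨i, hi, rfl⟩ := Finset.mem_image.1 hA
    rw [Finset.mem_filter] at hi
    rw [← hi.2]
    refine le_trans ?_ (hs (T W i))
    apply Finset.sum_le_sum_of_subset_of_nonneg
    · intro j hj
      simp only [Finset.mem_filter] at hj ⊢
      exact ⟨hj.1.1, hj.2 ▸ (hT W j hj.1.1).1⟩
    · intro j hj _
      exact hμ j (Finset.mem_filter.1 hj).1
  refine h1.trans ?_
  apply mul_le_mul_of_nonneg_right _ (pow_nonneg hq t)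
  norm_cast
  -- the choice function
  have hχ : ∃ χ : Finset α → Finset α, ∀ Z, (χ Z).card ≤ k ∧
      ((∃ i ∈ I, S i ⊆ Z) → ∃ i ∈ I, S i ⊆ Z ∧ χ Z = S i) := by
    have : ∀ Z : Finset α, ∃ Y : Finset α, Y.card ≤ k ∧
      ((∃ i ∈ I, S i ⊆ Z) → ∃ i ∈ I, S i ⊆ Z ∧ Y = S i) := by
      intro Z
      by_cases h : ∃ i ∈ I, S i ⊆ Z
      · obtain ⟨i, hi, hZ⟩ := h
        exact ⟨S i, hk i hi, fun _ => ⟨i, hi, hZ, rfl⟩⟩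
      · exact ⟨∅, by simp, fun h' => absurd h' h⟩
    choose χ hχ using this
    exact ⟨χ, hχ⟩
  obtain ⟨χ, hχ⟩ := hχ
  calc (P (X.powersetCard w)).card
      ≤ ((X.powersetCard (w+t)).sigma (fun Z => (χ Z).powersetCard t)).card := by
        apply Finset.card_le_card_of_injOn (fun p => ⟨p.1 ∪ p.2, p.2⟩)
        · rintro ⟨W, A⟩ h
          simp only [hP, Finset.coe_sigma, Set.mem_sigma_iff, Finset.mem_coe, Finset.mem_powersetCard,
            Finset.mem_image, Finset.mem_filter] at h ⊢
          obtain ⟨⟨hW, hWc⟩, i, ⟨hi, ht⟩, rfl⟩ := h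
          obtain ⟨g1, g2, ⟨j, hj, g3⟩, g4⟩ := hT W i hi
          refine ⟨⟨Finset.union_subset hW (g1.trans (hSX i hi)), ?_⟩, ?_, ht⟩
          · rw [Finset.card_union_of_disjoint g2, hWc, ht]
          · obtain ⟨l, hl, hlZ, hle⟩ := (hχ (W ∪ T W i)).2 ⟨j, hj, by
              rw [g3, Finset.union_sdiff_self_eq_union]; exact Finset.subset_union_right⟩
            rw [hle]; exact g4 l hl hlZ
        · rintro ⟨W, A⟩ h ⟨W', A'⟩ h' heq
          simp only [hP, Finset.coe_sigma, Set.mem_sigma_iff, Finset.mem_coe, Finset.mem_powersetCard,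
            Finset.mem_image, Finset.mem_filter] at h h'
          obtain ⟨⟨hW, hWc⟩, i, ⟨hi, ht⟩, rfl⟩ := h
          obtain ⟨⟨hW', hWc'⟩, i', ⟨hi', ht'⟩, rfl⟩ := h'
          simp only [Sigma.mk.injEq, heq_eq_eq] at heq ⊢
          refine ⟨?_, heq.2⟩
          have e1 := Finset.union_sdiff_cancel_right (hT W i hi).2.1
          have e2 := Finset.union_sdiff_cancel_right (hT W' i' hi').2.1
          rw [← e1, ← e2, heq.1, heq.2]
    _ ≤ _ := by
        rw [Finset.card_sigma, ← smul_eq_mul, ← Finset.card_powersetCard (w+t) X]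
        apply Finset.sum_le_card_nsmul
        intro Z _
        rw [Finset.card_powersetCard]
        exact Nat.choose_le_choose t (hχ Z).1

lemma frag_bound {α ι : Type*} [DecidableEq α] (I : Finset ι) (S : ι → Finset α) (μ : ι → ℝ)
    (X : Finset α) (k w : ℕ) (q x : ℝ) (hq : 0 ≤ q) (hw : 0 < w) (hx0 : 0 ≤ x) (hx : x ≤ 1/2)
    (hqx : X.card * q ≤ (x/2)^2 * w)
    (hSX : ∀ i ∈ I, S i ⊆ X) (hk : ∀ i ∈ I, (S i).card ≤ k)
    (hμ : ∀ i ∈ I, 0 ≤ μ i)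
    (hs : ∀ A : Finset α, ∑ i ∈ I.filter (fun i => A ⊆ S i), μ i ≤ q ^ A.card)
    (T : Finset α → ι → Finset α)
    (hT : ∀ W, ∀ i ∈ I, T W i ⊆ S i ∧ Disjoint W (T W i) ∧ (∃ j ∈ I, T W i = S j \ W) ∧
      ∀ j ∈ I, S j ⊆ W ∪ T W i → T W i ⊆ S j) :
    ∑ W ∈ X.powersetCard w, ∑ i ∈ I.filter (fun i => ¬ (T W i).card ≤ k/2), μ i ≤
      x ^ k * (X.card.choose w : ℝ) := by
  have h1 : ∀ W, ∑ i ∈ I.filter (fun i => ¬ (T W i).card ≤ k/2), μ i ≤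
      ∑ t ∈ Finset.Ioc (k/2) k, ∑ i ∈ I.filter (fun i => (T W i).card = t), μ i := by
    intro W
    rw [← Finset.sum_fiberwise_of_maps_to (s := I.filter (fun i => ¬ (T W i).card ≤ k/2))
      (t := Finset.Ioc (k/2) k) (g := fun i => (T W i).card)]
    · apply Finset.sum_le_sum
      intro t _
      apply Finset.sum_le_sum_of_subset_of_nonneg
      · intro j hj
        simp only [Finset.mem_filter] at hj ⊢
        exact ⟨hj.1.1, hj.2⟩
      · intro j hj _
        exact hμ j (Finset.mem_filter.1 hj).1
    · intro i hi
      rw [Finset.mem_filter] at hi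
      rw [Finset.mem_Ioc]
      exact ⟨not_le.1 hi.2, (Finset.card_le_card (hT W i hi.1).1).trans (hk i hi.1)⟩
  have hw' : (0:ℝ) < w := by exact_mod_cast hw
  have h2 : ∀ t ∈ Finset.Ioc (k/2) k, ((X.card.choose (w+t) * k.choose t : ℕ) : ℝ) * q ^ t ≤
      (k.choose t : ℝ) * ((x/2)^k * X.card.choose w) := by
    intro t ht
    rw [Finset.mem_Ioc] at ht
    have hc : (X.card.choose (w+t) : ℝ) * w ^ t ≤ X.card.choose w * X.card ^ t := by
      exact_mod_cast choose_add_le X.card w t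
    have h3 : (X.card.choose (w+t) : ℝ) * q ^ t ≤ (x/2)^k * X.card.choose w := by
      have h4 : ((X.card.choose (w+t) : ℝ) * q ^ t) * w ^ t ≤ ((x/2)^k * X.card.choose w) * w ^ t := by
        calc ((X.card.choose (w+t) : ℝ) * q ^ t) * w ^ t
            = ((X.card.choose (w+t) : ℝ) * w ^ t) * q ^ t := by ring
          _ ≤ (X.card.choose w * X.card ^ t) * q ^ t := by gcongr
          _ = X.card.choose w * (X.card * q) ^ t := by rw [mul_pow]; ring
          _ ≤ X.card.choose w * ((x/2)^2 * w) ^ t := by gcongr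
          _ = X.card.choose w * ((x/2)^(2*t)) * w ^ t := by rw [mul_pow, ← pow_mul]; ring
          _ ≤ X.card.choose w * ((x/2)^k) * w ^ t := by
              gcongr ?_ * ?_ * _
              apply pow_le_pow_of_le_one (by linarith) (by linarith); omega
          _ = _ := by ring
      exact le_of_mul_le_mul_right h4 (by positivity)
    push_cast
    calc (X.card.choose (w+t) : ℝ) * (k.choose t) * q ^ t = (k.choose t) * (X.card.choose (w+t) * q ^ t) := by ring
      _ ≤ _ := by gcongr
  calc ∑ W ∈ X.powersetCard w, ∑ i ∈ I.filter (fun i => ¬ (T W i).card ≤ k/2), μ i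
      ≤ ∑ W ∈ X.powersetCard w, ∑ t ∈ Finset.Ioc (k/2) k, ∑ i ∈ I.filter (fun i => (T W i).card = t), μ i :=
        Finset.sum_le_sum fun W _ => h1 W
    _ = ∑ t ∈ Finset.Ioc (k/2) k, ∑ W ∈ X.powersetCard w, ∑ i ∈ I.filter (fun i => (T W i).card = t), μ i :=
        Finset.sum_comm
    _ ≤ ∑ t ∈ Finset.Ioc (k/2) k, (k.choose t : ℝ) * ((x/2)^k * X.card.choose w) :=
        Finset.sum_le_sum fun t ht =>
          (frag_count I S μ X k w t q hq hSX hk hμ hs T hT).trans (h2 t ht)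
    _ ≤ ∑ t ∈ Finset.range (k+1), (k.choose t : ℝ) * ((x/2)^k * X.card.choose w) := by
        apply Finset.sum_le_sum_of_subset_of_nonneg
        · intro t ht
          simp only [Finset.mem_Ioc, Finset.mem_range] at ht ⊢; omega
        · intros; positivity
    _ = 2^k * ((x/2)^k * X.card.choose w) := by
        rw [← Finset.sum_mul]
        congr 1
        exact_mod_cast Nat.sum_range_choose k
    _ = _ := by rw [← mul_assoc, ← mul_pow]; congr 2; ring

theorem spread_main {α ι : Type*} [DecidableEq α] (μ : ι → ℝ) (w : ℕ) (q x : ℝ) (hq : 0 ≤ q) (hw : 0 < w)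
    (hx0 : 0 ≤ x) (hx : x ≤ 1/2) (l : ℕ) :
    ∀ (k : ℕ) (_ : k < 2 ^ l) (I : Finset ι) (S : ι → Finset α) (X : Finset α)
    (_ : X.card * q ≤ (x/2)^2 * w)
    (_ : ∀ i ∈ I, S i ⊆ X) (_ : ∀ i ∈ I, (S i).card ≤ k)
    (_ : ∀ i ∈ I, 0 ≤ μ i)
    (_ : ∀ A : Finset α, ∑ i ∈ I.filter (fun i => A ⊆ S i), μ i ≤ q ^ A.card),
    (((X.powersetCard (l * w)).filter (fun C => ∀ i ∈ I, ¬ S i ⊆ C)).card : ℝ) * ∑ i ∈ I, μ i ≤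
      (2 * x - 2 * x ^ (k+1)) * (X.card.choose (l * w) : ℝ) := by
  induction l with
  | zero =>
    intro k hk I S X _ _ hk' _ _
    have hk0 : k = 0 := by simpa using hk
    subst hk0
    rcases I.eq_empty_or_nonempty with rfl | ⟨i, hi⟩
    · simp
    · have : S i = ∅ := by simpa using hk' i hi
      have hf : (X.powersetCard (0 * w)).filter (fun C => ∀ i ∈ I, ¬ S i ⊆ C) = ∅ := by
        apply Finset.filter_eq_empty_iff.2
        intro C _ h
        exact h i hi (by simp [this])
      rw [hf]; simp
  | succ l ih =>
    intro k hk I S X hqX hSX hk' hμ hs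
    have hex : ∀ W : Finset α, ∀ i : ι, ∃ T : Finset α, i ∈ I → (T ⊆ S i ∧ Disjoint W T ∧
        (∃ j ∈ I, T = S j \ W) ∧ ∀ j ∈ I, S j ⊆ W ∪ T → T ⊆ S j) := by
      intro W i
      by_cases hi : i ∈ I
      · obtain ⟨T, hT⟩ := frag_exists I S W i hi
        exact ⟨T, fun _ => hT⟩
      · exact ⟨∅, fun h => absurd h hi⟩
    choose T hT using hex
    have hfb := frag_bound I S μ X k w q x hq hw hx0 hx hqX hSX hk' hμ hs T hT
    have hsplit := split_count X w (l * w) (fun C => ∀ i ∈ I, ¬ S i ⊆ C)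
    have hlw : (l+1) * w = w + l * w := by ring
    rw [hlw]
    rcases Nat.eq_zero_or_pos k with hk0 | hkpos
    · subst hk0
      rcases I.eq_empty_or_nonempty with rfl | ⟨i, hi⟩
      · simp
      · have : S i = ∅ := by simpa using hk' i hi
        have hf : (X.powersetCard (w + l * w)).filter (fun C => ∀ i ∈ I, ¬ S i ⊆ C) = ∅ := by
          apply Finset.filter_eq_empty_iff.2
          intro C _ h
          exact h i hi (by simp [this])
        rw [hf]; simp
    set m := ∑ i ∈ I, μ i with hm
    have hμsum : ∀ J ⊆ I, 0 ≤ ∑ i ∈ J, μ i := fun J hJ => Finset.sum_nonneg fun i hi => hμ i (hJ hi)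
    set g := 2 * x - 2 * x ^ (k/2+1) with hg
    have hstep : ∀ W ∈ X.powersetCard w,
        ((((X \ W).powersetCard (l*w)).filter (fun C => ∀ i ∈ I, ¬ S i ⊆ W ∪ C)).card : ℝ) * m ≤
        g * ((X.card - w).choose (l*w)) + ((X.card - w).choose (l*w) : ℝ) *
          ∑ i ∈ I.filter (fun i => ¬ (T W i).card ≤ k/2), μ i := by
      intro W hW
      rw [Finset.mem_powersetCard] at hW
      have hcard : (X \ W).card = X.card - w := by rw [Finset.card_sdiff_of_subset hW.1, hW.2]
      set I' := I.filter (fun i => (T W i).card ≤ k/2) with hI'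
      have hIH := ih (k/2) (by rw [pow_succ] at hk; omega) I' (T W) (X \ W) (by
          refine le_trans ?_ hqX
          gcongr; exact Finset.sdiff_subset) (by
          intro i hi
          rw [hI', Finset.mem_filter] at hi
          intro a ha
          rw [Finset.mem_sdiff]
          exact ⟨hSX i hi.1 ((hT W i hi.1).1 ha), fun h => Finset.disjoint_left.1 (hT W i hi.1).2.1 h ha⟩)
          (by intro i hi; exact (Finset.mem_filter.1 hi).2)
          (by intro i hi; exact hμ i (Finset.mem_filter.1 hi).1) (by
          intro A
          refine le_trans ?_ (hs A)
          apply Finset.sum_le_sum_of_subset_of_nonneg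
          · intro j hj
            simp only [hI', Finset.mem_filter] at hj ⊢
            exact ⟨hj.1.1, hj.2.trans (hT W j hj.1.1).1⟩
          · intro j hj _
            exact hμ j (Finset.mem_filter.1 hj).1)
      rw [hcard] at hIH
      have hm2 : m = ∑ i ∈ I', μ i + ∑ i ∈ I.filter (fun i => ¬ (T W i).card ≤ k/2), μ i :=
        (Finset.sum_filter_add_sum_filter_not I _ _).symm
      set F := ((X \ W).powersetCard (l*w)).filter (fun C => ∀ i ∈ I, ¬ S i ⊆ W ∪ C)
      set F' := ((X \ W).powersetCard (l*w)).filter (fun C => ∀ i ∈ I', ¬ T W i ⊆ C)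
      have hFF : F.card ≤ F'.card := by
        apply Finset.card_le_card
        intro C hC
        simp only [F, F', Finset.mem_filter] at hC ⊢
        refine ⟨hC.1, ?_⟩
        intro i hi hTC
        rw [hI', Finset.mem_filter] at hi
        obtain ⟨j, hj, hj2⟩ := (hT W i hi.1).2.2.1
        apply hC.2 j hj
        rw [hj2] at hTC
        intro a ha
        by_cases haW : a ∈ W
        · exact Finset.mem_union_left _ haW
        · exact Finset.mem_union_right _ (hTC (Finset.mem_sdiff.2 ⟨ha, haW⟩))
      have hFc : F.card ≤ (X.card - w).choose (l*w) := by
        refine (Finset.card_filter_le _ _).trans ?_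
        rw [Finset.card_powersetCard, hcard]
      rw [hm2, mul_add]
      apply add_le_add
      · refine le_trans ?_ hIH
        apply mul_le_mul_of_nonneg_right
        · exact_mod_cast hFF
        · exact hμsum _ (Finset.filter_subset _ _)
      · apply mul_le_mul_of_nonneg_right
        · exact_mod_cast hFc
        · exact hμsum _ (Finset.filter_subset _ _)
    have hchoose : (X.card.choose w : ℝ) * (X.card - w).choose (l*w) =
        X.card.choose (w + l*w) * (w+l*w).choose w := by
      have := Nat.choose_mul (n := X.card) (k := w + l*w) (s := w) (by omega)
      rw [Nat.add_sub_cancel_left] at this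
      exact_mod_cast this.symm
    have hpos : (0:ℝ) < (w + l*w).choose w := by
      exact_mod_cast Nat.choose_pos (by omega)
    have hgk : g + x^k ≤ 2 * x - 2 * x^(k+1) := by
      rw [hg]
      have e1 : x ^ k ≤ x ^ (k/2+1) := pow_le_pow_of_le_one hx0 (by linarith) (by omega)
      have e2 : 2 * x^(k+1) ≤ x^k := by
        rw [pow_succ]; nlinarith [pow_nonneg hx0 k]
      linarith
    have hfinal : ((((X.powersetCard (w + l * w)).filter (fun C => ∀ i ∈ I, ¬ S i ⊆ C)).card : ℝ) * m) *
        (w + l*w).choose w ≤ ((2 * x - 2 * x ^ (k+1)) * (X.card.choose (w + l * w) : ℝ)) * (w + l*w).choose w := by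
      have hs2 : (((X.powersetCard (w + l * w)).filter (fun C => ∀ i ∈ I, ¬ S i ⊆ C)).card : ℝ) *
          (w + l*w).choose w = ∑ W ∈ X.powersetCard w,
          ((((X \ W).powersetCard (l*w)).filter (fun C => ∀ i ∈ I, ¬ S i ⊆ W ∪ C)).card : ℝ) := by
        norm_cast
        convert hsplit
      calc _ = (∑ W ∈ X.powersetCard w,
          ((((X \ W).powersetCard (l*w)).filter (fun C => ∀ i ∈ I, ¬ S i ⊆ W ∪ C)).card : ℝ)) * m := by
            rw [← hs2]; ring
        _ ≤ ∑ W ∈ X.powersetCard w, (g * ((X.card - w).choose (l*w)) + ((X.card - w).choose (l*w) : ℝ) *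
          ∑ i ∈ I.filter (fun i => ¬ (T W i).card ≤ k/2), μ i) := by
            rw [Finset.sum_mul]; exact Finset.sum_le_sum hstep
        _ = X.card.choose w * (g * ((X.card - w).choose (l*w))) + ((X.card - w).choose (l*w) : ℝ) *
          ∑ W ∈ X.powersetCard w, ∑ i ∈ I.filter (fun i => ¬ (T W i).card ≤ k/2), μ i := by
            rw [Finset.sum_add_distrib, Finset.sum_const, Finset.card_powersetCard, nsmul_eq_mul,
              Finset.mul_sum]
        _ ≤ X.card.choose w * (g * ((X.card - w).choose (l*w))) + ((X.card - w).choose (l*w) : ℝ) *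
          (x ^ k * (X.card.choose w : ℝ)) := by gcongr
        _ = (g + x^k) * ((X.card.choose w : ℝ) * (X.card - w).choose (l*w)) := by ring
        _ = (g + x^k) * (X.card.choose (w + l*w) * (w+l*w).choose w) := by rw [hchoose]
        _ ≤ (2 * x - 2 * x ^ (k+1)) * (X.card.choose (w + l*w) * (w+l*w).choose w) := by gcongr
        _ = _ := by ring
    exact le_of_mul_le_mul_right hfinal hpos

/-- Perfect matchings of a vertex set `U` in the complete `r`-uniform hypergraph. -/
noncomputable def PMs {V : Type*} [DecidableEq V] (r : ℕ) (U : Finset V) : Finset (Finset (Finset V)) :=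
  ((U.powersetCard r).powerset).filter
    (fun T => (∀ e ∈ T, ∀ f ∈ T, e ≠ f → Disjoint e f) ∧ T.biUnion id = U)

lemma mem_PMs {V : Type*} [DecidableEq V] {r : ℕ} {U : Finset V} {T : Finset (Finset V)} :
    T ∈ PMs r U ↔ (∀ e ∈ T, e ⊆ U ∧ e.card = r) ∧ (∀ e ∈ T, ∀ f ∈ T, e ≠ f → Disjoint e f) ∧
      T.biUnion id = U := by
  unfold PMs
  rw [Finset.mem_filter, Finset.mem_powerset]
  constructor
  · rintro ⟨h1, h2⟩
    exact ⟨fun e he => Finset.mem_powersetCard.1 (h1 he), h2⟩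
  · rintro ⟨h1, h2⟩
    exact ⟨fun e he => Finset.mem_powersetCard.2 (h1 e he), h2⟩

lemma PMs_card {V : Type*} [DecidableEq V] {r : ℕ} {U : Finset V} {T : Finset (Finset V)}
    (h : T ∈ PMs r U) : T.card * r = U.card := by
  rw [mem_PMs] at h
  rw [← h.2.2, Finset.card_biUnion (t := id) (fun e he f hf hne => h.2.1 e he f hf hne)]
  rw [Finset.sum_const_nat (m := r)]
  intro e he; exact (h.1 e he).2

lemma PMs_erase {V : Type*} [DecidableEq V] {r : ℕ} (hr : 1 ≤ r) {U e : Finset V} (heU : e ⊆ U)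
    (hec : e.card = r) (A : Finset (Finset V)) (heA : e ∉ A) :
    ((PMs r U).filter (fun T => insert e A ⊆ T)).card = ((PMs r (U \ e)).filter (fun T => A ⊆ T)).card := by
  have hne : e.Nonempty := by rw [← Finset.card_pos]; omega
  refine Finset.card_nbij' (fun T => T.erase e) (fun T => insert e T) ?_ ?_ ?_ ?_
  · intro T hT
    simp only [Finset.coe_filter, Set.mem_ofPred_eq, mem_PMs] at hT ⊢
    obtain ⟨⟨h1, h2, h3⟩, h4⟩ := hT
    have heT : e ∈ T := h4 (Finset.mem_insert_self _ _)
    refine ⟨⟨?_, ?_, ?_⟩, ?_⟩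
    · intro f hf
      rw [Finset.mem_erase] at hf
      refine ⟨?_, (h1 f hf.2).2⟩
      rw [Finset.subset_sdiff]
      exact ⟨(h1 f hf.2).1, h2 f hf.2 e heT hf.1⟩
    · intro f hf g hg
      exact h2 f (Finset.mem_of_mem_erase hf) g (Finset.mem_of_mem_erase hg)
    · ext a
      simp only [Finset.mem_biUnion, Finset.mem_erase, id, Finset.mem_sdiff]
      constructor
      · rintro ⟨f, ⟨hfe, hf⟩, haf⟩
        exact ⟨(h1 f hf).1 haf, fun hae => Finset.disjoint_left.1 (h2 f hf e heT hfe) haf hae⟩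
      · rintro ⟨haU, hae⟩
        rw [← h3] at haU
        obtain ⟨f, hf, haf⟩ := Finset.mem_biUnion.1 haU
        exact ⟨f, ⟨fun h => hae (h ▸ haf), hf⟩, haf⟩
    · intro f hf
      rw [Finset.mem_erase]
      exact ⟨fun h => heA (h ▸ hf), h4 (Finset.mem_insert_of_mem hf)⟩
  · intro T hT
    simp only [Finset.coe_filter, Set.mem_ofPred_eq, mem_PMs] at hT ⊢
    obtain ⟨⟨h1, h2, h3⟩, h4⟩ := hT
    have hd : ∀ f ∈ T, Disjoint f e := fun f hf => (Finset.subset_sdiff.1 (h1 f hf).1).2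
    refine ⟨⟨?_, ?_, ?_⟩, ?_⟩
    · intro f hf
      rcases Finset.mem_insert.1 hf with rfl | hf
      · exact ⟨heU, hec⟩
      · exact ⟨(h1 f hf).1.trans Finset.sdiff_subset, (h1 f hf).2⟩
    · intro f hf g hg hfg
      rcases Finset.mem_insert.1 hf with h | hf <;> rcases Finset.mem_insert.1 hg with h' | hg
      · exact absurd (h.trans h'.symm) hfg
      · rw [h]; exact (hd g hg).symm
      · rw [h']; exact hd f hf
      · exact h2 f hf g hg hfg
    · rw [Finset.biUnion_insert, h3, id, Finset.union_sdiff_of_subset heU]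
    · exact Finset.insert_subset_insert _ h4
  · intro T hT
    simp only [Finset.coe_filter, Set.mem_ofPred_eq] at hT
    exact Finset.insert_erase (hT.2 (Finset.mem_insert_self _ _))
  · intro T hT
    simp only [Finset.coe_filter, Set.mem_ofPred_eq, mem_PMs] at hT
    apply Finset.erase_insert
    intro he
    have := Finset.subset_sdiff.1 (hT.1.1 e he).1
    exact hne.ne_empty (disjoint_self.1 this.2)

lemma card_filter_mem_powersetCard {V : Type*} [DecidableEq V] (r : ℕ) (U : Finset V) (v : V) (hv : v ∈ U) :
    ((U.powersetCard (r+1)).filter (fun e => v ∈ e)).card = (U.card - 1).choose r := by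
  rw [← Finset.card_erase_of_mem hv, ← Finset.card_powersetCard]
  refine Finset.card_nbij' (fun e => e.erase v) (fun e => insert v e) ?_ ?_ ?_ ?_
  · intro e he
    simp only [Finset.coe_filter, Finset.mem_powersetCard, Set.mem_ofPred_eq, Finset.mem_coe] at he ⊢
    refine ⟨Finset.erase_subset_erase _ he.1.1, ?_⟩
    rw [Finset.card_erase_of_mem he.2, he.1.2]; rfl
  · intro e he
    simp only [Finset.coe_filter, Finset.mem_powersetCard, Set.mem_ofPred_eq, Finset.mem_coe] at he ⊢
    have hve : v ∉ e := fun h => by simpa using he.1 h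
    refine ⟨⟨Finset.insert_subset hv (he.1.trans (Finset.erase_subset _ _)), ?_⟩, Finset.mem_insert_self _ _⟩
    rw [Finset.card_insert_of_notMem hve, he.2]
  · intro e he
    simp only [Finset.coe_filter, Finset.mem_powersetCard, Set.mem_ofPred_eq] at he
    exact Finset.insert_erase he.2
  · intro e he
    simp only [Finset.mem_coe, Finset.mem_powersetCard] at he
    exact Finset.erase_insert (fun h => by simpa using he.1 h)

lemma PMs_count {V : Type*} [DecidableEq V] (r : ℕ) (h : ℕ) : ∀ U : Finset V, U.card = (r+1) * h →
    (PMs (r+1) U).card = ∏ i ∈ Finset.range h, ((r+1)*i+r).choose r := by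
  induction h with
  | zero =>
    intro U hU
    have : U = ∅ := by simpa using hU
    subst this
    have : PMs (r+1) (∅ : Finset V) = {∅} := by
      ext T
      rw [mem_PMs, Finset.mem_singleton]
      constructor
      · rintro ⟨h1, -, -⟩
        by_contra hne
        obtain ⟨e, he⟩ := Finset.nonempty_iff_ne_empty.2 hne
        have := h1 e he
        have h2 : e = ∅ := Finset.subset_empty.1 this.1
        rw [h2] at this; simp at this
      · rintro rfl; simp
    rw [this]; simp
  | succ h ih =>
    intro U hU
    have hne : U.Nonempty := by rw [← Finset.card_pos, hU]; positivity
    obtain ⟨v, hv⟩ := hne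
    set E := (U.powersetCard (r+1)).filter (fun e => v ∈ e) with hE
    have h1 : (PMs (r+1) U).card = ∑ e ∈ E, ((PMs (r+1) U).filter (fun T => insert e ∅ ⊆ T)).card := by
      rw [← Finset.card_biUnion]
      · congr 1
        ext T
        simp only [Finset.mem_biUnion, Finset.mem_filter]
        constructor
        · intro hT
          have hT' := mem_PMs.1 hT
          have hvU := hv
          rw [← hT'.2.2] at hvU
          obtain ⟨e, he, hve⟩ := Finset.mem_biUnion.1 hvU
          refine ⟨e, ?_, hT, by simpa using he⟩
          rw [hE, Finset.mem_filter, Finset.mem_powersetCard]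
          exact ⟨hT'.1 e he, hve⟩
        · rintro ⟨e, _, hT, _⟩; exact hT
      · intro e he f hf hef
        rw [Function.onFun, Finset.disjoint_left]
        intro T hT hT2
        simp only [Finset.mem_filter, insert_empty_eq, Finset.singleton_subset_iff] at hT hT2
        have := (mem_PMs.1 hT.1).2.1 e hT.2 f hT2.2 hef
        rw [hE, Finset.mem_coe, Finset.mem_filter] at he hf
        exact Finset.disjoint_left.1 this he.2 hf.2
    rw [h1, Finset.sum_const_nat (m := ∏ i ∈ Finset.range h, ((r+1)*i+r).choose r), hE,
      card_filter_mem_powersetCard r U v hv, hU, Finset.prod_range_succ, mul_comm]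
    · congr 2
    · intro e he
      rw [hE, Finset.mem_filter, Finset.mem_powersetCard] at he
      rw [PMs_erase (by omega) he.1.1 he.1.2 ∅ (by simp)]
      simp only [Finset.empty_subset, Finset.filter_true]
      apply ih
      rw [Finset.card_sdiff_of_subset he.1.1, hU, he.1.2]
      rw [Nat.mul_succ]; omega

lemma PMs_contain {V : Type*} [DecidableEq V] (r : ℕ) (A : Finset (Finset V)) : ∀ (h : ℕ) (U : Finset V), U.card = (r+1) * h →
    ((PMs (r+1) U).filter (fun T => A ⊆ T)).card ≤ ∏ i ∈ Finset.range (h - A.card), ((r+1)*i+r).choose r := by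
  induction A using Finset.induction_on with
  | empty =>
    intro h U hU
    simp [PMs_count r h U hU]
  | insert e A he ih =>
    intro h U hU
    rcases Finset.eq_empty_or_nonempty ((PMs (r+1) U).filter (fun T => insert e A ⊆ T)) with h0 | ⟨T, hT⟩
    · rw [h0]; simp
    rw [Finset.mem_filter] at hT
    have hT' := (mem_PMs.1 hT.1).1 e (hT.2 (Finset.mem_insert_self _ _))
    rw [PMs_erase (by omega) hT'.1 hT'.2 A he, Finset.card_insert_of_notMem he]
    have := ih (h-1) (U \ e) (by
      rw [Finset.card_sdiff_of_subset hT'.1, hU, hT'.2, Nat.mul_sub, mul_one])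
    rwa [Nat.sub_sub, add_comm 1] at this

lemma pow_le_choose_mul (k c : ℕ) (hk : 0 < k) (hc : 0 < c) : c ^ k ≤ (k*c).choose k := by
  have := choose_ratio k (k*c) k (Nat.le_mul_of_pos_right k hc)
  rw [Nat.choose_self, one_mul, mul_pow, mul_comm] at this
  exact Nat.le_of_mul_le_mul_right this (by positivity)

lemma desc_bound (h a : ℕ) (ha : a ≤ h) :
    ((h:ℝ) / Real.exp 1) ^ a ≤ ∏ i ∈ Finset.Ico (h-a) h, ((i:ℝ)+1) := by
  have h1 : ∏ i ∈ Finset.Ico (h-a) h, ((i:ℝ)+1) = (h.descFactorial a : ℝ) := by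
    rw [Finset.prod_Ico_eq_prod_range, Nat.sub_sub_self ha, Nat.descFactorial_eq_prod_range,
      ← Finset.prod_range_reflect]
    push_cast
    apply Finset.prod_congr rfl
    intro i hi
    rw [Finset.mem_range] at hi
    rw [Nat.cast_sub (by omega : i ≤ h)]
    have : h - a + (a - 1 - i) + 1 = h - i := by omega
    rw [← Nat.cast_sub (by omega : i ≤ h), ← this]; push_cast; ring
  rw [h1]
  have h2 := choose_ratio a h a ha
  rw [Nat.choose_self, one_mul] at h2
  have h3 : (h:ℝ)^a ≤ h.choose a * (a:ℝ)^a := by exact_mod_cast h2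
  have h4 : (a:ℝ)^a / a.factorial ≤ Real.exp a := Real.pow_div_factorial_le_exp _ (by positivity) _
  have h5 : (h.descFactorial a : ℝ) = a.factorial * h.choose a := by
    exact_mod_cast Nat.descFactorial_eq_factorial_mul_choose h a
  rw [div_le_iff₀ (by positivity)] at h4
  rw [div_pow, ← Real.exp_nat_mul, mul_one, div_le_iff₀ (by positivity), h5]
  calc (h:ℝ)^a ≤ h.choose a * (a:ℝ)^a := h3
    _ ≤ h.choose a * (Real.exp a * a.factorial) := by gcongr
    _ = _ := by ring

lemma PMs_spread {V : Type*} [DecidableEq V] (r : ℕ) (hr : 0 < r) (A : Finset (Finset V)) (h : ℕ) (U : Finset V)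
    (hU : U.card = (r+1) * h) :
    (((PMs (r+1) U).filter (fun T => A ⊆ T)).card : ℝ) * (((h:ℝ) / Real.exp 1) ^ r) ^ A.card ≤ (PMs (r+1) U).card := by
  rcases Finset.eq_empty_or_nonempty ((PMs (r+1) U).filter (fun T => A ⊆ T)) with h0 | ⟨T, hT⟩
  · rw [h0]; simp
  rw [Finset.mem_filter] at hT
  have hAh : A.card ≤ h := by
    have h1 := PMs_card hT.1
    have h2 := Finset.card_le_card hT.2
    rw [hU, mul_comm] at h1
    have := Nat.eq_of_mul_eq_mul_left (by omega) h1
    omega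
  have h1 := PMs_contain r A h U hU
  rw [PMs_count r h U hU, ← Finset.prod_range_mul_prod_Ico _ (Nat.sub_le h A.card)]
  push_cast
  apply mul_le_mul
  · exact_mod_cast h1
  · calc (((h:ℝ) / Real.exp 1) ^ r) ^ A.card = (((h:ℝ) / Real.exp 1) ^ A.card) ^ r := by
          rw [← pow_mul, ← pow_mul, mul_comm]
      _ ≤ (∏ i ∈ Finset.Ico (h-A.card) h, ((i:ℝ)+1)) ^ r := by
          gcongr; exact desc_bound h _ hAh
      _ = ∏ i ∈ Finset.Ico (h-A.card) h, ((i:ℝ)+1) ^ r := by rw [Finset.prod_pow]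
      _ ≤ _ := by
          apply Finset.prod_le_prod
          · intros; positivity
          · intro i _
            have h3 := pow_le_choose_mul r (i+1) hr (by omega)
            have h4 : (r * (i+1)).choose r ≤ ((r+1)*i+r).choose r := Nat.choose_le_choose _ (by nlinarith)
            exact_mod_cast h3.trans h4
  · positivity
  · positivity

lemma PMs_pos {V : Type*} [DecidableEq V] (r : ℕ) (h : ℕ) (U : Finset V)
    (hU : U.card = (r+1) * h) : 0 < (PMs (r+1) U).card := by
  rw [PMs_count r h U hU]
  apply Finset.prod_pos
  intro i _
  exact Nat.choose_pos (by omega)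

lemma count_superset {V : Type*} [DecidableEq V] (X B : Finset V) (hB : B ⊆ X) (s : ℕ) (hs : s ≤ X.card) :
    ((X.powersetCard s).filter (fun R => B ⊆ R)).card * X.card ^ B.card ≤ X.card.choose s * s ^ B.card := by
  by_cases hbs : B.card ≤ s
  · have h1 : ((X.powersetCard s).filter (fun R => B ⊆ R)).card ≤ (X.card - B.card).choose (s - B.card) := by
      rw [← Finset.card_sdiff_of_subset hB, ← Finset.card_powersetCard]
      apply Finset.card_le_card_of_injOn (fun R => R \ B)
      · intro R hR
        simp only [Finset.coe_filter, Set.mem_ofPred_eq, Finset.mem_powersetCard] at hR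
        simp only [Finset.mem_coe, Finset.mem_powersetCard]
        refine ⟨Finset.sdiff_subset_sdiff hR.1.1 le_rfl, ?_⟩
        rw [Finset.card_sdiff_of_subset hR.2, hR.1.2]
      · intro R hR R' hR' h
        simp only [Finset.coe_filter, Set.mem_ofPred_eq] at hR hR'
        simp only at h
        rw [← Finset.sdiff_union_of_subset hR.2, h, Finset.sdiff_union_of_subset hR'.2]
    have h2 := Nat.choose_mul (n := X.card) hbs
    have h3 := choose_ratio s X.card B.card hs
    have h4 : 0 < X.card.choose B.card := Nat.choose_pos (Finset.card_le_card hB)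
    apply Nat.le_of_mul_le_mul_left _ h4
    calc _ = (X.card.choose B.card * ((X.powersetCard s).filter (fun R => B ⊆ R)).card) * X.card ^ B.card := by ring
      _ ≤ (X.card.choose B.card * (X.card - B.card).choose (s - B.card)) * X.card ^ B.card := by gcongr
      _ = X.card.choose s * (s.choose B.card * X.card ^ B.card) := by rw [← h2]; ring
      _ ≤ X.card.choose s * (X.card.choose B.card * s ^ B.card) := by gcongr
      _ = _ := by ring
  · have : (X.powersetCard s).filter (fun R => B ⊆ R) = ∅ := by
      apply Finset.filter_false_of_mem
      intro R hR h
      have := Finset.card_le_card h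
      rw [(Finset.mem_powersetCard.1 hR).2] at this
      exact hbs this
    rw [this]; simp

lemma matching_card {V : Type*} [DecidableEq V] {r : ℕ} {U : Finset V} {T A : Finset (Finset V)}
    (h : T ∈ PMs r U) (hA : A ⊆ T) : (A.biUnion id).card = r * A.card := by
  rw [mem_PMs] at h
  rw [Finset.card_biUnion (t := id) (fun e he f hf hne => h.2.1 e (hA he) f (hA hf) hne)]
  rw [Finset.sum_const_nat (m := r), mul_comm]
  intro e he; exact (h.1 e (hA he)).2

/-- the key spread application -/
theorem spread_apply (r n s : ℕ) (hr : 0 < r) (hs0 : 0 < s) (hs : s ≤ n) (H1 : Finset (Finset (Fin n)))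
    (Good : Finset (Finset (Fin n))) (hGood : Good ⊆ Finset.univ.powersetCard s)
    (U : Finset (Fin n) → Finset (Fin n)) (hUR : ∀ R ∈ Good, U R ⊆ R) (hUs : ∀ R ∈ Good, s ≤ 2 * (U R).card)
    (hUd : ∀ R ∈ Good, (r+1) ∣ (U R).card) (l w : ℕ) (hw : 0 < w) (x : ℝ) (hx0 : 0 ≤ x) (hx : x ≤ 1/2)
    (hl : n < 2 ^ l)
    (hq : ((allEdges (r+1) n).card : ℝ) * (((s:ℝ)/n)^(r+1) * (2*(r+1)*Real.exp 1 / s)^r) ≤ (x/2)^2 * w) :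
    ((((allEdges (r+1) n \ H1).powersetCard (l*w)).filter
      (fun C => ∀ R ∈ Good, ∀ T ∈ PMs (r+1) (U R), ¬ T \ H1 ⊆ C)).card : ℝ) * (Good.card / (n.choose s : ℝ))
      ≤ 2 * x * ((allEdges (r+1) n \ H1).card.choose (l*w) : ℝ) := by
  set q : ℝ := ((s:ℝ)/n)^(r+1) * (2*(r+1)*Real.exp 1 / s)^r with hqd
  have hn0 : 0 < n := by omega
  have hq0 : 0 ≤ q := by positivity
  set I := Good.sigma (fun R => PMs (r+1) (U R)) with hI
  set μ : (Σ _ : Finset (Fin n), Finset (Finset (Fin n))) → ℝ :=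
    fun i => 1 / ((n.choose s : ℝ) * (PMs (r+1) (U i.1)).card) with hμ
  have hPpos : ∀ R ∈ Good, 0 < (PMs (r+1) (U R)).card := by
    intro R hR
    obtain ⟨h, hh⟩ := hUd R hR
    exact PMs_pos r h _ hh
  have hcn : (0:ℝ) < n.choose s := by exact_mod_cast Nat.choose_pos hs
  have hsum : ∑ i ∈ I, μ i = Good.card / (n.choose s : ℝ) := by
    rw [hI, Finset.sum_sigma]
    rw [div_eq_mul_inv, ← nsmul_eq_mul, ← Finset.sum_const]
    apply Finset.sum_congr rfl
    intro R hR
    have := hPpos R hR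
    simp only [hμ, Finset.sum_const, nsmul_eq_mul]
    field_simp
  have key := spread_main μ w q x hq0 hw hx0 hx l n hl I (fun i => i.2 \ H1) (allEdges (r+1) n \ H1)
    (by
      refine le_trans ?_ hq
      gcongr
      exact Finset.sdiff_subset) ?_ ?_ ?_ ?_
  · rw [hsum] at key
    have e1 : ((allEdges (r+1) n \ H1).powersetCard (l*w)).filter
      (fun C => ∀ R ∈ Good, ∀ T ∈ PMs (r+1) (U R), ¬ T \ H1 ⊆ C) =
      ((allEdges (r+1) n \ H1).powersetCard (l*w)).filter (fun C => ∀ i ∈ I, ¬ i.2 \ H1 ⊆ C) := by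
      apply Finset.filter_congr
      intro C _
      constructor
      · intro h i hi
        rw [hI, Finset.mem_sigma] at hi
        exact h i.1 hi.1 i.2 hi.2
      · intro h R hR T hT
        exact h ⟨R, T⟩ (Finset.mem_sigma.2 ⟨hR, hT⟩)
    rw [e1]
    have h9 : (2 * x - 2 * x ^ (n+1)) * ((allEdges (r+1) n \ H1).card.choose (l*w) : ℝ) ≤
        2 * x * ((allEdges (r+1) n \ H1).card.choose (l*w) : ℝ) := by
      refine mul_le_mul_of_nonneg_right ?_ (Nat.cast_nonneg _)
      have : 0 ≤ x ^ (n+1) := pow_nonneg hx0 _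
      linarith
    have h10 := le_trans key h9
    clear_value I μ q
    refine le_trans (le_of_eq ?_) h10
    congr 3
    ext C
    simp only [Finset.mem_filter]
  · intro i hi
    rw [hI, Finset.mem_sigma] at hi
    apply Finset.sdiff_subset_sdiff _ le_rfl
    intro e he
    exact Finset.mem_powersetCard.2 ⟨Finset.subset_univ _, ((mem_PMs.1 hi.2).1 e he).2⟩
  · intro i hi
    rw [hI, Finset.mem_sigma] at hi
    have h1 := PMs_card hi.2
    have h2 : (U i.1).card ≤ n := by simpa using Finset.card_le_univ (U i.1)
    have h3 : (i.2 \ H1).card ≤ i.2.card := Finset.card_le_card Finset.sdiff_subset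
    nlinarith
  · intro i _; positivity
  · intro A
    by_cases hA : ∃ R ∈ Good, ∃ T ∈ PMs (r+1) (U R), A ⊆ T
    · obtain ⟨R0, _, T0, hT0, hAT0⟩ := hA
      have hVA := matching_card hT0 hAT0
      set VA := A.biUnion id with hVAd
      rw [Finset.sum_filter, hI, Finset.sum_sigma]
      have hstep : ∀ R ∈ Good, (∑ T ∈ PMs (r+1) (U R), if A ⊆ T \ H1 then μ ⟨R,T⟩ else 0) ≤
          if VA ⊆ R then (1 / (n.choose s : ℝ)) * ((2*(r+1)*Real.exp 1 / s)^r) ^ A.card else 0 := by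
        intro R hR
        obtain ⟨h, hh⟩ := hUd R hR
        have hsp := PMs_spread r hr A h (U R) hh
        have hP := hPpos R hR
        have hle : (∑ T ∈ PMs (r+1) (U R), if A ⊆ T \ H1 then μ ⟨R,T⟩ else 0) ≤
          (((PMs (r+1) (U R)).filter (fun T => A ⊆ T)).card : ℝ) * (1 / ((n.choose s : ℝ) * (PMs (r+1) (U R)).card)) := by
          rw [← nsmul_eq_mul, ← Finset.sum_const, Finset.sum_filter]
          apply Finset.sum_le_sum
          intro T _
          split_ifs with h1 h2 h3
          · exact le_rfl
          · exact absurd (h1.trans Finset.sdiff_subset) h2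
          · positivity
          · exact le_rfl
        refine hle.trans ?_
        split_ifs with hv
        · have hpos : (0:ℝ) < (s:ℝ) / (2*(r+1)*Real.exp 1) := by positivity
          have hge : (s:ℝ) / (2*(r+1)*Real.exp 1) ≤ (h:ℝ)/Real.exp 1 := by
            rw [div_le_div_iff₀ (by positivity) (by positivity)]
            have := hUs R hR
            rw [hh] at this
            have h5 : (s:ℝ) ≤ 2 * ((r+1) * h) := by exact_mod_cast this
            have := Real.exp_pos 1
            nlinarith
          have h6 : (((PMs (r+1) (U R)).filter (fun T => A ⊆ T)).card : ℝ) * ((((s:ℝ) / (2*(r+1)*Real.exp 1))) ^ r) ^ A.card ≤ (PMs (r+1) (U R)).card := by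
            refine le_trans ?_ hsp
            gcongr
          have h7 : (2*(r+1)*Real.exp 1 / (s:ℝ)) = ((s:ℝ) / (2*(r+1)*Real.exp 1))⁻¹ := by rw [inv_div]
          rw [h7, inv_pow, inv_pow, ← div_eq_mul_inv, mul_one_div, div_div, div_le_div_iff₀ (by positivity) (by positivity)]
          have := mul_le_mul_of_nonneg_right h6 hcn.le
          linarith
        · have : (PMs (r+1) (U R)).filter (fun T => A ⊆ T) = ∅ := by
            apply Finset.filter_false_of_mem
            intro T hT hAT
            apply hv
            intro v hvA
            apply hUR R hR
            rw [← (mem_PMs.1 hT).2.2]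
            exact Finset.biUnion_subset_biUnion_of_subset_left _ hAT hvA
          rw [this]; simp
      refine (Finset.sum_le_sum hstep).trans ?_
      rw [← Finset.sum_filter, Finset.sum_const, nsmul_eq_mul]
      have hc := count_superset (Finset.univ : Finset (Fin n)) VA (Finset.subset_univ _) s (by simpa using hs)
      rw [Finset.card_univ, Fintype.card_fin, hVA] at hc
      have hc2 : ((Good.filter (fun R => VA ⊆ R)).card : ℝ) * (n:ℝ)^((r+1)*A.card) ≤ n.choose s * (s:ℝ)^((r+1)*A.card) := by
        have hc' : (((Finset.powersetCard s (Finset.univ : Finset (Fin n))).filter (fun R => VA ⊆ R)).card : ℝ) * (n:ℝ)^((r+1)*A.card) ≤ n.choose s * (s:ℝ)^((r+1)*A.card) := by exact_mod_cast hc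
        refine le_trans ?_ hc'
        gcongr
      have hnp : (0:ℝ) < (n:ℝ)^((r+1)*A.card) := by positivity
      have hc3 : ((Good.filter (fun R => VA ⊆ R)).card : ℝ) ≤ n.choose s * ((s:ℝ)/n)^((r+1)*A.card) := by
        rw [div_pow, ← mul_div_assoc, le_div_iff₀ hnp]; exact hc2
      calc _ ≤ (n.choose s * ((s:ℝ)/n)^((r+1)*A.card)) * ((1 / (n.choose s : ℝ)) * ((2*(r+1)*Real.exp 1 / s)^r) ^ A.card) := by
            gcongr
        _ = q ^ A.card := by
            rw [hqd, mul_pow, pow_mul]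
            field_simp
    · have : I.filter (fun i => A ⊆ i.2 \ H1) = ∅ := by
        apply Finset.filter_false_of_mem
        intro i hi h
        rw [hI, Finset.mem_sigma] at hi
        exact hA ⟨i.1, hi.1, i.2, hi.2, h.trans Finset.sdiff_subset⟩
      rw [this]; simp only [Finset.sum_empty]; positivity

lemma exp_moment {E : Type*} [Fintype E] (d κ : ℕ) (Z : E → Prop) [DecidablePred Z] (X : ℝ) (hX : 1 ≤ X) :
    (((Finset.univ : Finset (Fin d → E)).filter
      (fun f => κ ≤ ((Finset.univ : Finset (Fin d)).filter (fun j => Z (f j))).card)).card : ℝ) * X ^ κ ≤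
    ((Fintype.card E : ℝ) + (X - 1) * ((Finset.univ : Finset E).filter Z).card) ^ d := by
  have h1 : ((Fintype.card E : ℝ) + (X - 1) * ((Finset.univ : Finset E).filter Z).card) =
      ∑ e : E, (if Z e then X else 1) := by
    have : ∀ e : E, (if Z e then X else 1) = 1 + (if Z e then (X - 1) else 0) := by
      intro e; split_ifs <;> ring
    simp_rw [this]
    rw [Finset.sum_add_distrib, ← Finset.sum_filter, Finset.sum_const, Finset.sum_const, nsmul_eq_mul, nsmul_eq_mul,
      Finset.card_univ]
    ring
  have h2 : (∑ e : E, (if Z e then X else 1)) ^ d = ∑ f : (Fin d → E), ∏ j, (if Z (f j) then X else 1) := by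
    have := Finset.prod_univ_sum (fun _ : Fin d => (Finset.univ : Finset E)) (fun _ e => if Z e then X else 1)
    simpa using this
  rw [h1, h2, ← nsmul_eq_mul, ← Finset.sum_const]
  have h3 : ∀ f : Fin d → E, ∏ j, (if Z (f j) then X else 1) =
      X ^ ((Finset.univ : Finset (Fin d)).filter (fun j => Z (f j))).card := by
    intro f
    rw [Finset.prod_ite]; simp
  calc _ ≤ ∑ f ∈ (Finset.univ : Finset (Fin d → E)).filter (fun f => κ ≤ ((Finset.univ : Finset (Fin d)).filter (fun j => Z (f j))).card),
            ∏ j, (if Z (f j) then X else 1) := by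
        apply Finset.sum_le_sum
        intro f hf
        rw [h3]
        exact pow_le_pow_right₀ hX (Finset.mem_filter.1 hf).2
    _ ≤ _ := by
        apply Finset.sum_le_sum_of_subset_of_nonneg (Finset.filter_subset _ _)
        intro f _ _
        rw [h3]; positivity

lemma loo {ι : Type*} [Fintype ι] [DecidableEq ι] {F : ι → Type*} [∀ i, Fintype (F i)] 
    (v : ι) (Ev : (∀ i, F i) → Prop) [DecidablePred Ev] (p : ℝ)
    (h : ∀ a, (((Finset.univ : Finset (F v)).filter (fun f => Ev (Function.update a v f))).card : ℝ) ≤ p * Fintype.card (F v)) :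
    (((Finset.univ : Finset (∀ i, F i)).filter Ev).card : ℝ) ≤ p * Fintype.card (∀ i, F i) := by
  by_cases hne : Nonempty (F v)
  · have e : ((∀ i, F i) × F v) ≃ ((∀ i, F i) × F v) :=
      { toFun := fun x => (Function.update x.1 v x.2, x.1 v)
        invFun := fun x => (Function.update x.1 v x.2, x.1 v)
        left_inv := by intro x; simp
        right_inv := by intro x; simp }
    have hc : 0 < (Fintype.card (F v) : ℝ) := by exact_mod_cast Fintype.card_pos
    have h1 : ((Finset.univ : Finset (∀ i, F i)).filter Ev).card * Fintype.card (F v) =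
        ∑ a : (∀ i, F i), ((Finset.univ : Finset (F v)).filter (fun f => Ev (Function.update a v f))).card := by
      have h2 : ((Finset.univ : Finset (∀ i, F i)).filter Ev).card * Fintype.card (F v) =
          ((Finset.univ : Finset ((∀ i, F i) × F v)).filter (fun x => Ev x.1)).card := by
        rw [← Finset.card_univ, ← Finset.card_product]
        congr 1; ext x; simp
      have h3 : ((Finset.univ : Finset ((∀ i, F i) × F v)).filter (fun x => Ev (Function.update x.1 v x.2))).card =
          ∑ a : (∀ i, F i), ((Finset.univ : Finset (F v)).filter (fun f => Ev (Function.update a v f))).card := by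
        simp_rw [Finset.card_filter]
        rw [Fintype.sum_prod_type]
      rw [h2, ← h3]
      refine Finset.card_nbij' (fun x => (Function.update x.1 v x.2, x.1 v)) (fun x => (Function.update x.1 v x.2, x.1 v)) ?_ ?_ ?_ ?_
      · intro x hx
        simp at hx ⊢
        exact hx
      · intro x hx
        simp at hx ⊢
        exact hx
      · intro x _; simp
      · intro x _; simp
    have h4 : (((Finset.univ : Finset (∀ i, F i)).filter Ev).card : ℝ) * Fintype.card (F v) ≤
        (p * Fintype.card (∀ i, F i)) * Fintype.card (F v) := by
      have : (((Finset.univ : Finset (∀ i, F i)).filter Ev).card : ℝ) * Fintype.card (F v) =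
        ∑ a : (∀ i, F i), (((Finset.univ : Finset (F v)).filter (fun f => Ev (Function.update a v f))).card : ℝ) := by
        exact_mod_cast h1
      rw [this]
      refine (Finset.sum_le_sum (fun a _ => h a)).trans ?_
      rw [Finset.sum_const, nsmul_eq_mul, Finset.card_univ]
      apply le_of_eq; ring
    exact le_of_mul_le_mul_right h4 hc
  · have : IsEmpty (F v) := not_nonempty_iff.1 hne
    have : IsEmpty (∀ i, F i) := ⟨fun a => this.false (a v)⟩
    simp

lemma star_count (r n : ℕ) (v : Fin n) (Z : Finset (Fin n) → Prop) [DecidablePred Z] :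
    ((Finset.univ : Finset {e : Finset (Fin n) // e.card = r+1 ∧ v ∈ e}).filter (fun e => Z (e.1.erase v))).card =
    (((Finset.univ.erase v).powersetCard r).filter Z).card := by
  refine Finset.card_bij (fun e _ => e.1.erase v) ?_ ?_ ?_
  · intro e he
    simp only [Finset.mem_filter, Finset.mem_univ, true_and] at he
    simp only [Finset.mem_filter, Finset.mem_powersetCard]
    refine ⟨⟨Finset.erase_subset_erase _ (Finset.subset_univ _), ?_⟩, he⟩
    rw [Finset.card_erase_of_mem e.2.2, e.2.1]; simp
  · intro e _ e' _ h
    apply Subtype.ext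
    rw [← Finset.insert_erase e.2.2, h, Finset.insert_erase e'.2.2]
  · intro f hf
    simp only [Finset.mem_filter, Finset.mem_powersetCard] at hf
    have hv : v ∉ f := fun h => by simpa using hf.1.1 h
    refine ⟨⟨insert v f, ?_, Finset.mem_insert_self _ _⟩, ?_, ?_⟩
    · rw [Finset.card_insert_of_notMem hv, hf.1.2]
    · simp only [Finset.mem_filter, Finset.mem_univ, true_and, Finset.erase_insert hv]
      exact hf.2
    · simp [Finset.erase_insert hv]

lemma star_card (r n : ℕ) (v : Fin n) :
    Fintype.card {e : Finset (Fin n) // e.card = r+1 ∧ v ∈ e} = (n-1).choose r := by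
  have := star_count r n v (fun _ => True)
  simp only [Finset.filter_true] at this
  rw [Finset.card_univ, Finset.card_powersetCard] at this
  rw [this]; simp

lemma star_in (r n : ℕ) (v : Fin n) (R : Finset (Fin n)) (hv : v ∉ R) :
    ((Finset.univ : Finset {e : Finset (Fin n) // e.card = r+1 ∧ v ∈ e}).filter (fun e => e.1.erase v ⊆ R)).card =
      R.card.choose r := by
  rw [star_count r n v (fun f => f ⊆ R), ← Finset.card_powersetCard]
  congr 1
  ext f
  simp only [Finset.mem_filter, Finset.mem_powersetCard]
  constructor
  · tauto
  · rintro ⟨h1, h2⟩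
    refine ⟨⟨?_, h2⟩, h1⟩
    intro u hu
    rw [Finset.mem_erase]
    exact ⟨fun h => hv (h ▸ h1 hu), Finset.mem_univ _⟩

lemma star_hit (r n : ℕ) (v : Fin n) (D : Finset (Fin n)) :
    ((Finset.univ : Finset {e : Finset (Fin n) // e.card = r+1+1 ∧ v ∈ e}).filter (fun e => ¬ Disjoint (e.1.erase v) D)).card *
      (n-1) ≤ D.card * (r+1) * (n-1).choose (r+1) := by
  rw [star_count (r+1) n v (fun f => ¬ Disjoint f D)]
  have h1 : (((Finset.univ.erase v).powersetCard (r+1)).filter (fun f => ¬ Disjoint f D)).card ≤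
      ∑ u ∈ D.erase v, (((Finset.univ.erase v).powersetCard (r+1)).filter (fun f => u ∈ f)).card := by
    refine le_trans (Finset.card_le_card ?_) Finset.card_biUnion_le
    intro f hf
    simp only [Finset.mem_filter, Finset.mem_biUnion] at hf ⊢
    obtain ⟨u, huf, huD⟩ := Finset.not_disjoint_iff.1 hf.2
    refine ⟨u, ?_, hf.1, huf⟩
    rw [Finset.mem_erase]
    refine ⟨fun h => ?_, huD⟩
    have := (Finset.mem_powersetCard.1 hf.1).1 huf
    simp [h] at this
  have h2 : ∀ u ∈ D.erase v, (((Finset.univ.erase v).powersetCard (r+1)).filter (fun f => u ∈ f)).card = (n-1-1).choose r := by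
    intro u hu
    have hu' : u ∈ Finset.univ.erase v := by
      rw [Finset.mem_erase] at hu ⊢; exact ⟨hu.1, Finset.mem_univ _⟩
    have := card_filter_mem_powersetCard r (Finset.univ.erase v) u hu'
    rw [Finset.card_erase_of_mem (Finset.mem_univ _), Finset.card_univ, Fintype.card_fin] at this
    exact this
  rw [Finset.sum_congr rfl h2, Finset.sum_const, smul_eq_mul] at h1
  rcases Nat.eq_zero_or_pos (n-1) with h0 | h0
  · rw [h0]; simp
  obtain ⟨m, hm⟩ : ∃ m, n - 1 = m + 1 := ⟨n-1-1, by omega⟩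
  rw [hm] at h1 ⊢
  have h3 := Nat.add_one_mul_choose_eq m r
  have h4 : (D.erase v).card ≤ D.card := Finset.card_le_card (Finset.erase_subset _ _)
  simp only [Nat.add_sub_cancel] at h1
  calc _ ≤ ((D.erase v).card * m.choose r) * (m+1) := Nat.mul_le_mul_right _ h1
    _ ≤ (D.card * m.choose r) * (m+1) := by gcongr
    _ = D.card * ((m+1) * m.choose r) := by ring
    _ = _ := by rw [h3]; ring

lemma hit_prob (r n d κ bD : ℕ) (v : Fin n) (hn : 2 ≤ n) (D : Picks (r+1+1) n d → Finset (Fin n))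
    (hD : ∀ a f, D (Function.update a v f) = D a) (y : ℝ) (hy0 : 0 < y) (hy1 : y ≤ 1)
    (hy : (bD : ℝ) * (r+1) ≤ y * ((n:ℝ)-1)) :
    (((Finset.univ : Finset (Picks (r+1+1) n d)).filter (fun a => (D a).card ≤ bD ∧
      κ ≤ ((Finset.univ : Finset (Fin d)).filter (fun j => ¬ Disjoint ((a v j).1.erase v) (D a))).card)).card : ℝ) ≤
      (2 ^ d * y ^ κ) * Fintype.card (Picks (r+1+1) n d) := by
  apply loo v
  intro a
  by_cases hb : (D a).card ≤ bD
  · set E := {e : Finset (Fin n) // e.card = r+1+1 ∧ v ∈ e}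
    have h1 := exp_moment (E := E) d κ (fun e => ¬ Disjoint (e.1.erase v) (D a)) (1/y) (by
      rw [le_div_iff₀ hy0]; linarith)
    have h2 := star_hit r n v (D a)
    have hE : Fintype.card E = (n-1).choose (r+1) := star_card (r+1) n v
    have h3 : (((Finset.univ : Finset E).filter (fun e => ¬ Disjoint (e.1.erase v) (D a))).card : ℝ) ≤ y * Fintype.card E := by
      have hn' : (0:ℝ) < (n:ℝ) - 1 := by
        have : (2:ℝ) ≤ n := by exact_mod_cast hn
        linarith
      have h2' : (((Finset.univ : Finset E).filter (fun e => ¬ Disjoint (e.1.erase v) (D a))).card : ℝ) * ((n:ℝ)-1) ≤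
          (D a).card * (r+1) * Fintype.card E := by
        rw [hE]
        have : ((n-1 : ℕ) : ℝ) = (n:ℝ) - 1 := by push_cast [show 1 ≤ n by omega]; ring
        rw [← this]
        exact_mod_cast h2
      have hb' : ((D a).card : ℝ) ≤ bD := by exact_mod_cast hb
      apply le_of_mul_le_mul_right _ hn'
      refine h2'.trans ?_
      calc ((D a).card : ℝ) * (r+1) * Fintype.card E ≤ bD * (r+1) * Fintype.card E := by gcongr
        _ ≤ (y * ((n:ℝ)-1)) * Fintype.card E := by gcongr
        _ = _ := by ring
    have h4 : ((Fintype.card E : ℝ) + (1/y - 1) * ((Finset.univ : Finset E).filter (fun e => ¬ Disjoint (e.1.erase v) (D a))).card) ≤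
        2 * Fintype.card E := by
      have h5 : 0 ≤ 1/y - 1 := by
        rw [sub_nonneg, le_div_iff₀ hy0]; linarith
      have := mul_le_mul_of_nonneg_left h3 h5
      have h6 : (1/y - 1) * (y * (Fintype.card E : ℝ)) = Fintype.card E - y * Fintype.card E := by
        field_simp
      have h7 : 0 ≤ y * (Fintype.card E : ℝ) := by positivity
      linarith
    have h8 := h1.trans (pow_le_pow_left₀ (by
      have h5 : 0 ≤ 1/y - 1 := by
        rw [sub_nonneg, le_div_iff₀ hy0]; linarith
      positivity) h4 d)
    rw [one_div, inv_pow, ← div_eq_mul_inv, div_le_iff₀ (by positivity)] at h8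
    refine le_trans ?_ (h8.trans (le_of_eq ?_))
    · gcongr with f
      intro h
      simp only [hD, Function.update_self] at h
      exact h.2
    · rw [mul_pow, Fintype.card_fun, Fintype.card_fin]
      push_cast
      ring
  · rw [Finset.filter_false_of_mem]
    · simp only [Finset.card_empty, Nat.cast_zero]; positivity
    · intro f _
      rw [hD]
      exact fun h => hb h.1

lemma poor_prob (r n d κ : ℕ) (v : Fin n) (R : Finset (Fin n)) (hv : v ∉ R) (p0 : ℝ)
    (hp : p0 * ((n-1).choose (r+1) : ℝ) ≤ (R.card.choose (r+1) : ℝ)) :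
    (((Finset.univ : Finset (Picks (r+1+1) n d)).filter (fun a =>
      ((Finset.univ : Finset (Fin d)).filter (fun j => (a v j).1.erase v ⊆ R)).card < κ)).card : ℝ) ≤
      (2 ^ κ * (1 - p0/2) ^ d) * Fintype.card (Picks (r+1+1) n d) := by
  apply loo v
  intro a
  set E := {e : Finset (Fin n) // e.card = r+1+1 ∧ v ∈ e}
  have h1 := exp_moment (E := E) d (d - κ) (fun e => ¬ e.1.erase v ⊆ R) 2 (by norm_num)
  have h2 := star_in (r+1) n v R hv
  have hE : Fintype.card E = (n-1).choose (r+1) := star_card (r+1) n v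
  have h3 := Finset.card_filter_add_card_filter_not (s := (Finset.univ : Finset E)) (fun e => e.1.erase v ⊆ R)
  rw [h2, Finset.card_univ] at h3
  have h3' : (R.card.choose (r+1) : ℝ) + (((Finset.univ : Finset E).filter (fun e => ¬ e.1.erase v ⊆ R)).card : ℝ) = Fintype.card E := by
    exact_mod_cast h3
  rw [← hE] at hp
  have h4 : ((Fintype.card E : ℝ) + (2 - 1) * ((Finset.univ : Finset E).filter (fun e => ¬ e.1.erase v ⊆ R)).card) ≤
      (2 * (1 - p0/2)) * Fintype.card E := by linarith
  have h8 := h1.trans (pow_le_pow_left₀ (by norm_num; positivity) h4 d)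
  have h9 : ((Finset.univ : Finset (Fin d → E)).filter (fun f => 
      ((Finset.univ : Finset (Fin d)).filter (fun j => (f j).1.erase v ⊆ R)).card < κ)).card ≤
      ((Finset.univ : Finset (Fin d → E)).filter (fun f => 
      d - κ ≤ ((Finset.univ : Finset (Fin d)).filter (fun j => ¬ (f j).1.erase v ⊆ R)).card)).card := by
    apply Finset.card_le_card
    intro f hf
    simp only [Finset.mem_filter, Finset.mem_univ, true_and] at hf ⊢
    have := Finset.card_filter_add_card_filter_not (s := (Finset.univ : Finset (Fin d))) (fun j => (f j).1.erase v ⊆ R)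
    rw [Finset.card_univ, Fintype.card_fin] at this
    omega
  have h10 : (2:ℝ)^d ≤ 2^κ * 2^(d-κ) := by
    rw [← pow_add]; exact pow_le_pow_right₀ (by norm_num) (by omega)
  simp only [Function.update_self]
  have h11 : (((Finset.univ : Finset (Fin d → E)).filter (fun f => 
      ((Finset.univ : Finset (Fin d)).filter (fun j => (f j).1.erase v ⊆ R)).card < κ)).card : ℝ) * 2^(d-κ) ≤
      ((2 * (1 - p0/2)) * Fintype.card E)^d := by
    refine le_trans ?_ h8
    gcongr
  have hpos : 0 ≤ ((1 - p0/2) * (Fintype.card E : ℝ))^d := by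
    apply pow_nonneg
    have : (0:ℝ) ≤ (((Finset.univ : Finset E).filter (fun e => ¬ e.1.erase v ⊆ R)).card : ℝ) := by positivity
    have : (0:ℝ) ≤ (Fintype.card E : ℝ) := by positivity
    linarith
  apply le_of_mul_le_mul_right _ (show (0:ℝ) < 2^(d-κ) by positivity)
  refine h11.trans ?_
  rw [Fintype.card_fun, Fintype.card_fin]
  push_cast
  calc _ = 2^d * ((1 - p0/2) * (Fintype.card E : ℝ))^d := by rw [← mul_pow]; ring
    _ ≤ (2^κ * 2^(d-κ)) * ((1 - p0/2) * (Fintype.card E : ℝ))^d := by gcongr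
    _ = _ := by rw [mul_pow]; ring



noncomputable def gpick {n : ℕ} (C : Finset (Finset (Fin n))) (v : Fin n) (U : Finset (Fin n)) : Finset (Fin n) :=
  if h : ∃ e ∈ C, Disjoint (e.erase v) U then h.choose else ∅

noncomputable def gU {n : ℕ} (J D0 : Finset (Fin n)) (cand : Fin n → Finset (Finset (Fin n))) : ℕ → Finset (Fin n)
  | 0 => D0
  | i+1 => if h : i < n then (if (⟨i, h⟩ : Fin n) ∈ J then gU J D0 cand i ∪ gpick (cand ⟨i, h⟩) ⟨i, h⟩ (gU J D0 cand i)
      else gU J D0 cand i) else gU J D0 cand i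

lemma gU_local {n : ℕ} (J D0 : Finset (Fin n)) (cand cand' : Fin n → Finset (Finset (Fin n))) (i : ℕ)
    (h : ∀ u ∈ J, u.1 < i → cand u = cand' u) : gU J D0 cand i = gU J D0 cand' i := by
  induction i with
  | zero => rfl
  | succ i ih =>
    have ih' := ih (fun u hu hi => h u hu (by omega))
    simp only [gU, ih']
    split_ifs with h1 h2
    · rw [h _ h2 (Nat.lt_succ_self i)]
    · rfl
    · rfl

lemma gU_sub {n : ℕ} (J D0 : Finset (Fin n)) (cand : Fin n → Finset (Finset (Fin n))) (i : ℕ) :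
    D0 ⊆ gU J D0 cand i := by
  induction i with
  | zero => exact subset_rfl
  | succ i ih =>
    simp only [gU]
    split_ifs
    · exact ih.trans Finset.subset_union_left
    · exact ih
    · exact ih

lemma gU_card {n r : ℕ} (J D0 : Finset (Fin n)) (cand : Fin n → Finset (Finset (Fin n)))
    (hc : ∀ v, ∀ e ∈ cand v, e.card ≤ r) (i : ℕ) :
    (gU J D0 cand i).card ≤ D0.card + r * J.card := by
  have : (gU J D0 cand i).card ≤ D0.card + r * (J.filter (fun u => u.1 < i)).card := by
    induction i with
    | zero => simp [gU]
    | succ i ih =>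
      have hmono : (J.filter (fun u => u.1 < i)).card ≤ (J.filter (fun u => u.1 < i+1)).card := by
        apply Finset.card_le_card
        intro u hu
        rw [Finset.mem_filter] at hu ⊢
        exact ⟨hu.1, by omega⟩
      have hm2 := Nat.mul_le_mul_left r hmono
      simp only [gU]
      split_ifs with h1 h2
      · have hlt : (J.filter (fun u => u.1 < i)).card + 1 ≤ (J.filter (fun u => u.1 < i+1)).card := by
          rw [← Finset.card_insert_of_notMem (a := (⟨i,h1⟩ : Fin n)) (by simp)]
          apply Finset.card_le_card
          intro u hu
          rw [Finset.mem_insert, Finset.mem_filter] at hu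
          rw [Finset.mem_filter]
          rcases hu with rfl | hu
          · exact ⟨h2, Nat.lt_succ_self i⟩
          · exact ⟨hu.1, by omega⟩
        have hp : (gpick (cand ⟨i,h1⟩) ⟨i,h1⟩ (gU J D0 cand i)).card ≤ r := by
          unfold gpick
          split_ifs with h
          · exact hc _ _ h.choose_spec.1
          · simp
        have := Finset.card_union_le (gU J D0 cand i) (gpick (cand ⟨i,h1⟩) ⟨i,h1⟩ (gU J D0 cand i))
        nlinarith
      · omega
      · omega
  refine this.trans ?_
  gcongr
  exact Finset.filter_subset _ _

lemma gU_success {n : ℕ} (J D0 : Finset (Fin n)) (hJ : J ⊆ D0) (cand : Fin n → Finset (Finset (Fin n)))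
    (hc : ∀ v, ∀ e ∈ cand v, v ∈ e)
    (hs : ∀ v ∈ J, ∃ e ∈ cand v, Disjoint (e.erase v) (gU J D0 cand v.1)) (i : ℕ) :
    ∃ M : Finset (Finset (Fin n)), (∀ e ∈ M, ∃ v ∈ J, v.1 < i ∧ e ∈ cand v ∧ Disjoint (e.erase v) D0) ∧
      (∀ e ∈ M, ∀ f ∈ M, e ≠ f → Disjoint e f) ∧ gU J D0 cand i = D0 ∪ M.biUnion id ∧
      ∀ v ∈ J, v.1 < i → v ∈ M.biUnion id := by
  induction i with
  | zero => exact ⟨∅, by simp, by simp, by simp [gU], by simp⟩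
  | succ i ih =>
    obtain ⟨M, h1, h2, h3, h4⟩ := ih
    by_cases hi : i < n
    · by_cases hiJ : (⟨i, hi⟩ : Fin n) ∈ J
      · have hex := hs _ hiJ
        set v : Fin n := ⟨i, hi⟩ with hv
        have hex' : ∃ e ∈ cand v, Disjoint (e.erase v) (gU J D0 cand i) := hex
        set e := gpick (cand v) v (gU J D0 cand i) with he
        have hev : e = hex'.choose := by rw [he]; unfold gpick; rw [dif_pos hex']
        have he1 : e ∈ cand v := by rw [hev]; exact hex'.choose_spec.1
        have he2 : Disjoint (e.erase v) (gU J D0 cand i) := by rw [hev]; exact hex'.choose_spec.2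
        have he3 : ∀ f ∈ M, Disjoint e f := by
          intro f hf
          rw [Finset.disjoint_left]
          intro u hue huf
          by_cases huv : u = v
          · obtain ⟨v', hv'J, hv'i, _, hd⟩ := h1 f hf
            have hne : u ≠ v' := by
              intro h
              have : v.1 = v'.1 := by rw [← huv, h]
              simp only [hv] at this
              omega
            exact Finset.disjoint_left.1 hd (Finset.mem_erase.2 ⟨hne, huf⟩) (huv ▸ hJ hiJ)
          · refine Finset.disjoint_left.1 he2 (Finset.mem_erase.2 ⟨huv, hue⟩) ?_
            rw [h3]
            exact Finset.mem_union_right _ (Finset.mem_biUnion.2 ⟨f, hf, huf⟩)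
        refine ⟨insert e M, ?_, ?_, ?_, ?_⟩
        · intro f hf
          rcases Finset.mem_insert.1 hf with rfl | hf
          · exact ⟨v, hiJ, Nat.lt_succ_self i, he1, he2.mono_right (gU_sub _ _ _ _)⟩
          · obtain ⟨v', a1, a2, a3⟩ := h1 f hf
            exact ⟨v', a1, by omega, a3⟩
        · intro f hf g hg hne
          rcases Finset.mem_insert.1 hf with hf | hf <;> rcases Finset.mem_insert.1 hg with hg | hg
          · exact absurd (hf.trans hg.symm) hne
          · rw [hf]; exact he3 g hg
          · rw [hg]; exact (he3 f hf).symm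
          · exact h2 f hf g hg hne
        · simp only [gU]
          rw [dif_pos hi, if_pos hiJ, ← he, h3, Finset.biUnion_insert]
          simp only [id, Finset.union_assoc]
          rw [Finset.union_comm e]
        · intro u hu hui
          rw [Finset.biUnion_insert]
          by_cases huv : u.1 = i
          · have : u = v := Fin.ext huv
            rw [this]
            exact Finset.mem_union_left _ (hc v e he1)
          · exact Finset.mem_union_right _ (h4 u hu (by omega))
      · refine ⟨M, ?_, h2, ?_, ?_⟩
        · intro f hf
          obtain ⟨v', a1, a2, a3⟩ := h1 f hf
          exact ⟨v', a1, by omega, a3⟩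
        · simp only [gU]
          rw [dif_pos hi, if_neg hiJ, h3]
        · intro u hu hui
          refine h4 u hu ?_
          rcases Nat.lt_or_ge u.1 i with h | h
          · exact h
          · exact absurd (show (⟨i, hi⟩ : Fin n) ∈ J by
              have : u = ⟨i, hi⟩ := Fin.ext (by simp; omega)
              rwa [← this]) hiJ
    · refine ⟨M, ?_, h2, ?_, ?_⟩
      · intro f hf
        obtain ⟨v', a1, a2, a3⟩ := h1 f hf
        exact ⟨v', a1, by omega, a3⟩
      · simp only [gU]
        rw [dif_neg hi, h3]
      · intro u hu hui
        exact h4 u hu (by have := u.2; omega)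

lemma exists_maxmatch {V : Type*} [Fintype V] [DecidableEq V] (H1 : Finset (Finset V)) (hne : ∀ e ∈ H1, e.Nonempty) (W : Finset V) :
    ∃ M : Finset (Finset V), M ⊆ H1 ∧ (∀ e ∈ M, ∀ f ∈ M, e ≠ f → Disjoint e f) ∧ (M.biUnion id ⊆ W) ∧
      ∀ e ∈ H1, ¬ e ⊆ W \ M.biUnion id := by
  set S := H1.powerset.filter (fun M => (∀ e ∈ M, ∀ f ∈ M, e ≠ f → Disjoint e f) ∧ (M.biUnion id ⊆ W)) with hS
  have hSne : S.Nonempty := ⟨∅, by rw [hS, Finset.mem_filter]; simp⟩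
  obtain ⟨M, hM, hmax⟩ := Finset.exists_max_image S Finset.card hSne
  have hM' := hM
  rw [hS, Finset.mem_filter, Finset.mem_powerset] at hM'
  refine ⟨M, hM'.1, hM'.2.1, hM'.2.2, ?_⟩
  intro e he hsub
  rw [Finset.subset_sdiff] at hsub
  have hd : ∀ f ∈ M, Disjoint e f := fun f hf => hsub.2.mono_right (Finset.subset_biUnion_of_mem id hf)
  have heM : e ∉ M := by
    intro h
    have := hd e h
    rw [disjoint_self] at this
    exact (hne e he).ne_empty this
  have : insert e M ∈ S := by
    rw [hS, Finset.mem_filter, Finset.mem_powerset]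
    refine ⟨Finset.insert_subset he hM'.1, ?_, ?_⟩
    · intro f hf g hg hfg
      rcases Finset.mem_insert.1 hf with hf | hf <;> rcases Finset.mem_insert.1 hg with hg | hg
      · exact absurd (hf.trans hg.symm) hfg
      · rw [hf]; exact hd g hg
      · rw [hg]; exact (hd f hf).symm
      · exact hM'.2.1 f hf g hg hfg
    · rw [Finset.biUnion_insert]
      exact Finset.union_subset hsub.1 hM'.2.2
  have := hmax _ this
  rw [Finset.card_insert_of_notMem heM] at this
  omega

noncomputable def mm {n : ℕ} (H1 : Finset (Finset (Fin n))) (W : Finset (Fin n)) : Finset (Finset (Fin n)) :=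
  if h : ∀ e ∈ H1, e.Nonempty then (exists_maxmatch H1 h W).choose else ∅

noncomputable def Jf {n : ℕ} (H1 : Finset (Finset (Fin n))) (R Q : Finset (Fin n)) : Finset (Fin n) :=
  (Finset.univ \ (R ∪ Q)) \ (mm H1 (Finset.univ \ (R ∪ Q))).biUnion id

noncomputable def pAll {k n d : ℕ} (a : Picks k n d) (v : Fin n) : Finset (Finset (Fin n)) :=
  Finset.univ.image (fun j => (a v j).1)

noncomputable def pR {k n d : ℕ} (R : Finset (Fin n)) (a : Picks k n d) (v : Fin n) : Finset (Finset (Fin n)) :=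
  (pAll a v).filter (fun e => e.erase v ⊆ R)

noncomputable def Bp {k n d : ℕ} (R : Finset (Fin n)) (κ : ℕ) (a : Picks k n d) : Finset (Fin n) :=
  Finset.univ.filter (fun v => v ∉ R ∧ ((Finset.univ : Finset (Fin d)).filter (fun j => (a v j).1.erase v ⊆ R)).card < κ)

noncomputable def D1 {k n d : ℕ} (R : Finset (Fin n)) (κ : ℕ) (v : Fin n) (a : Picks k n d) : Finset (Fin n) :=
  gU (insert v (Bp R κ a)) (insert v (Bp R κ a)) (pAll a) v.1

noncomputable def D2 {k n d : ℕ} (H1 : Finset (Finset (Fin n))) (R : Finset (Fin n)) (κ : ℕ) (v : Fin n) (a : Picks k n d) : Finset (Fin n) :=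
  gU (Jf H1 R (gU ((Bp R κ a).erase v) ((Bp R κ a).erase v) (pAll a) n))
    (Jf H1 R (gU ((Bp R κ a).erase v) ((Bp R κ a).erase v) (pAll a) n) ∪
      (gU ((Bp R κ a).erase v) ((Bp R κ a).erase v) (pAll a) n)) (pR R a) v.1

lemma pAll_update {k n d : ℕ} (a : Picks k n d) (v : Fin n) (f) (u : Fin n) (h : u ≠ v) :
    pAll (Function.update a v f) u = pAll a u := by
  unfold pAll
  simp only [Function.update_of_ne h]

lemma pR_update {k n d : ℕ} (R : Finset (Fin n)) (a : Picks k n d) (v : Fin n) (f) (u : Fin n) (h : u ≠ v) :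
    pR R (Function.update a v f) u = pR R a u := by
  unfold pR
  rw [pAll_update _ _ _ _ h]

lemma Bp_update_mem {k n d : ℕ} (R : Finset (Fin n)) (κ : ℕ) (a : Picks k n d) (v : Fin n) (f) (u : Fin n) (h : u ≠ v) :
    u ∈ Bp R κ (Function.update a v f) ↔ u ∈ Bp R κ a := by
  unfold Bp
  simp only [Finset.mem_filter, Function.update_of_ne h]

lemma Bp_insert {k n d : ℕ} (R : Finset (Fin n)) (κ : ℕ) (a : Picks k n d) (v : Fin n) (f) :
    insert v (Bp R κ (Function.update a v f)) = insert v (Bp R κ a) := by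
  ext u
  simp only [Finset.mem_insert]
  by_cases h : u = v
  · simp [h]
  · rw [Bp_update_mem _ _ _ _ _ _ h]

lemma Bp_erase {k n d : ℕ} (R : Finset (Fin n)) (κ : ℕ) (a : Picks k n d) (v : Fin n) (f) :
    (Bp R κ (Function.update a v f)).erase v = (Bp R κ a).erase v := by
  ext u
  simp only [Finset.mem_erase]
  by_cases h : u = v
  · simp [h]
  · rw [Bp_update_mem _ _ _ _ _ _ h]

lemma D1_update {k n d : ℕ} (R : Finset (Fin n)) (κ : ℕ) (v : Fin n) (a : Picks k n d) (f) :
    D1 R κ v (Function.update a v f) = D1 R κ v a := by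
  unfold D1
  rw [Bp_insert]
  apply gU_local
  intro u _ hu
  exact pAll_update _ _ _ _ (fun h => by rw [h] at hu; omega)

lemma D2_update {k n d : ℕ} (H1 : Finset (Finset (Fin n))) (R : Finset (Fin n)) (κ : ℕ) (v : Fin n) (a : Picks k n d) (f) :
    D2 H1 R κ v (Function.update a v f) = D2 H1 R κ v a := by
  unfold D2
  rw [Bp_erase]
  have : gU ((Bp R κ a).erase v) ((Bp R κ a).erase v) (pAll (Function.update a v f)) n =
      gU ((Bp R κ a).erase v) ((Bp R κ a).erase v) (pAll a) n := by
    apply gU_local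
    intro u hu _
    exact pAll_update _ _ _ _ (Finset.mem_erase.1 hu).1
  rw [this]
  apply gU_local
  intro u _ hu
  exact pR_update _ _ _ _ _ (fun h => by rw [h] at hu; omega)

def hitEv {k n d : ℕ} (κ bD : ℕ) (v : Fin n) (D : Picks k n d → Finset (Fin n)) (a : Picks k n d) : Prop :=
  (D a).card ≤ bD ∧ κ ≤ ((Finset.univ : Finset (Fin d)).filter (fun j => ¬ Disjoint ((a v j).1.erase v) (D a))).card

def GoodR {k n d : ℕ} (H1 : Finset (Finset (Fin n))) (R : Finset (Fin n)) (a : Picks k n d) : Prop :=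
  ∃ M : Finset (Finset (Fin n)), M ⊆ edgesOf a ∪ H1 ∧ (∀ e ∈ M, ∀ f ∈ M, e ≠ f → Disjoint e f) ∧
    Finset.univ \ M.biUnion id ⊆ R ∧ R.card ≤ 2 * (Finset.univ \ M.biUnion id).card

lemma mem_pAll {k n d : ℕ} {a : Picks k n d} {v : Fin n} {e} (h : e ∈ pAll a v) : e ∈ edgesOf a ∧ e.card = k ∧ v ∈ e := by
  unfold pAll at h
  obtain ⟨j, _, rfl⟩ := Finset.mem_image.1 h
  refine ⟨?_, (a v j).2⟩
  unfold edgesOf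
  exact Finset.mem_biUnion.2 ⟨v, Finset.mem_univ _, Finset.mem_image.2 ⟨j, Finset.mem_univ _, rfl⟩⟩

lemma good_of {k n d : ℕ} (H1 : Finset (Finset (Fin n))) (hH1 : ∀ e ∈ H1, e.Nonempty) (R : Finset (Fin n)) (κ bD b b1 : ℕ)
    (a : Picks k n d) (hκ1 : 1 ≤ κ) (hκ : κ ≤ d)
    (hE1 : ∀ J : Finset (Fin n), b1 ≤ J.card → ∃ e ∈ H1, e ⊆ J)
    (hB : (Bp R κ a).card ≤ b) (hbD : (k+1) * (b + 1 + b1) ≤ bD) (hRb : 2 * ((k+1) * (b + b1)) ≤ R.card)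
    (h1 : ∀ v, ¬ hitEv κ bD v (D1 R κ v) a) (h2 : ∀ v, ¬ hitEv κ bD v (D2 H1 R κ v) a) :
    GoodR H1 R a := by
  set B := Bp R κ a with hBd
  have hcA : ∀ v, ∀ e ∈ pAll a v, e.card ≤ k := fun v e he => (mem_pAll he).2.1.le
  have hcR : ∀ v, ∀ e ∈ pR R a v, e.card ≤ k := fun v e he => hcA v e (Finset.mem_filter.1 he).1
  -- phase B
  obtain ⟨MB, hB1, hB2, hB3, hB4⟩ := gU_success B B subset_rfl (pAll a) (fun v e he => (mem_pAll he).2.2) (by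
    intro v hv
    by_contra hcon
    push Not at hcon
    apply h1 v
    have hDv : D1 R κ v a = gU B B (pAll a) v.1 := by
      unfold D1; rw [← hBd, Finset.insert_eq_of_mem hv]
    refine ⟨?_, ?_⟩
    · rw [hDv]
      have := gU_card B B (pAll a) hcA v.1
      nlinarith
    · rw [Finset.filter_true_of_mem, Finset.card_univ, Fintype.card_fin]
      · exact hκ
      · intro j _
        rw [hDv]
        exact hcon _ (Finset.mem_image.2 ⟨j, Finset.mem_univ _, rfl⟩)) n
  set Q := gU B B (pAll a) n with hQ
  have hQc : Q.card ≤ (k+1) * b := by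
    have := gU_card B B (pAll a) hcA n
    rw [← hQ] at this
    nlinarith
  have hBQ : B ⊆ Q := gU_sub _ _ _ _
  -- maximal matching
  set W := Finset.univ \ (R ∪ Q) with hW
  have hmm : mm H1 W = (exists_maxmatch H1 hH1 W).choose := by unfold mm; rw [dif_pos hH1]
  obtain ⟨m1, m2, m3, m4⟩ := (exists_maxmatch H1 hH1 W).choose_spec
  rw [← hmm] at m1 m2 m3 m4
  set M0 := mm H1 W with hM0
  set J := Jf H1 R Q with hJ
  have hJW : J = W \ M0.biUnion id := rfl
  have hJc : J.card ≤ b1 := by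
    by_contra h
    obtain ⟨e, he, heJ⟩ := hE1 J (by omega)
    exact m4 e he (hJW ▸ heJ)
  have hgJ : ∀ i, (gU J (J ∪ Q) (pR R a) i).card ≤ (k+1) * (b + b1) := by
    intro i
    have q1 := gU_card J (J ∪ Q) (pR R a) hcR i
    have q2 := Finset.card_union_le J Q
    nlinarith
  obtain ⟨MJ, hJ1, hJ2, hJ3, hJ4⟩ := gU_success J (J ∪ Q) Finset.subset_union_left (pR R a)
    (fun v e he => (mem_pAll (Finset.mem_filter.1 he).1).2.2) (by
    intro v hv
    by_contra hcon
    push Not at hcon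
    apply h2 v
    have hvW : v ∈ W := (Finset.mem_sdiff.1 (hJW ▸ hv)).1
    have hvRQ := (Finset.mem_sdiff.1 hvW).2
    rw [Finset.mem_union] at hvRQ
    push Not at hvRQ
    have hvB : v ∉ B := fun h => hvRQ.2 (hBQ h)
    have hDv : D2 H1 R κ v a = gU J (J ∪ Q) (pR R a) v.1 := by
      unfold D2; rw [← hBd, Finset.erase_eq_of_notMem hvB]
    refine ⟨?_, ?_⟩
    · rw [hDv]
      have := hgJ v.1
      nlinarith
    · have hrich : κ ≤ ((Finset.univ : Finset (Fin d)).filter (fun j => (a v j).1.erase v ⊆ R)).card := by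
        by_contra h
        apply hvB
        rw [hBd]; unfold Bp
        rw [Finset.mem_filter]
        exact ⟨Finset.mem_univ _, hvRQ.1, by omega⟩
      refine hrich.trans (Finset.card_le_card ?_)
      intro j hj
      rw [Finset.mem_filter] at hj ⊢
      refine ⟨Finset.mem_univ _, ?_⟩
      rw [hDv]
      exact hcon _ (Finset.mem_filter.2 ⟨Finset.mem_image.2 ⟨j, Finset.mem_univ _, rfl⟩, hj.2⟩)) n
  have hQV : Q = MB.biUnion id := by
    rw [hB3]
    apply Finset.union_eq_right.2
    intro v hv
    exact hB4 v hv v.2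
  have dB0 : Disjoint (MB.biUnion id) (M0.biUnion id) := by
    rw [← hQV]
    refine Disjoint.mono_right m3 ?_
    rw [hW]
    exact Finset.disjoint_sdiff.mono_left Finset.subset_union_right
  have hJe : ∀ e ∈ MJ, Disjoint e Q ∧ Disjoint e (M0.biUnion id) := by
    intro e he
    obtain ⟨v, hvJ, _, hec, hd⟩ := hJ1 e he
    have heR := (Finset.mem_filter.1 hec).2
    have hvJ' := hvJ
    rw [hJW, Finset.mem_sdiff, hW, Finset.mem_sdiff, Finset.mem_union] at hvJ'
    constructor
    · rw [Finset.disjoint_left]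
      intro u hue huQ
      by_cases huv : u = v
      · exact hvJ'.1.2 (Or.inr (huv ▸ huQ))
      · exact Finset.disjoint_left.1 hd (Finset.mem_erase.2 ⟨huv, hue⟩) (Finset.mem_union_right _ huQ)
    · rw [Finset.disjoint_left]
      intro u hue huM
      by_cases huv : u = v
      · exact hvJ'.2 (huv ▸ huM)
      · have := heR (Finset.mem_erase.2 ⟨huv, hue⟩)
        have h3 := m3 huM
        rw [hW, Finset.mem_sdiff, Finset.mem_union] at h3
        exact h3.2 (Or.inl this)
  have hsub : ∀ {M : Finset (Finset (Fin n))} {e}, e ∈ M → e ⊆ M.biUnion id :=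
    fun {M e} he => Finset.subset_biUnion_of_mem id he
  refine ⟨MB ∪ M0 ∪ MJ, ?_, ?_, ?_, ?_⟩
  · intro e he
    rw [Finset.mem_union, Finset.mem_union] at he
    rcases he with (he | he) | he
    · obtain ⟨v, _, _, hec, _⟩ := hB1 e he
      exact Finset.mem_union_left _ (mem_pAll hec).1
    · exact Finset.mem_union_right _ (m1 he)
    · obtain ⟨v, _, _, hec, _⟩ := hJ1 e he
      exact Finset.mem_union_left _ (mem_pAll (Finset.mem_filter.1 hec).1).1
  · intro e he f hf hne
    rw [Finset.mem_union, Finset.mem_union] at he hf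
    rcases he with (he | he) | he <;> rcases hf with (hf | hf) | hf
    · exact hB2 e he f hf hne
    · exact dB0.mono (hsub he) (hsub hf)
    · exact ((hJe f hf).1.mono_right (hQV ▸ hsub he)).symm
    · exact (dB0.mono (hsub hf) (hsub he)).symm
    · exact m2 e he f hf hne
    · exact ((hJe f hf).2.mono_right (hsub he)).symm
    · exact ((hJe e he).1.mono_right (hQV ▸ hsub hf))
    · exact ((hJe e he).2.mono_right (hsub hf))
    · exact hJ2 e he f hf hne
  · intro v hv
    by_contra hvR
    rw [Finset.mem_sdiff, Finset.union_biUnion, Finset.union_biUnion, Finset.mem_union, Finset.mem_union, ← hQV] at hv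
    push Not at hv
    apply hv.2.2
    apply hJ4 v _ v.2
    rw [hJW, Finset.mem_sdiff, hW, Finset.mem_sdiff, Finset.mem_union]
    exact ⟨⟨Finset.mem_univ _, by tauto⟩, hv.2.1.2⟩
  · have hR : R ⊆ (Finset.univ \ (MB ∪ M0 ∪ MJ).biUnion id) ∪ gU J (J ∪ Q) (pR R a) n := by
      intro v hv
      rw [hJ3]
      by_cases hvM : v ∈ (MB ∪ M0 ∪ MJ).biUnion id
      · apply Finset.mem_union_right
        rw [Finset.union_biUnion, Finset.union_biUnion, Finset.mem_union, Finset.mem_union, ← hQV] at hvM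
        rw [Finset.mem_union, Finset.mem_union]
        rcases hvM with (h | h) | h
        · exact Or.inl (Or.inr h)
        · have h3 := m3 h
          rw [hW, Finset.mem_sdiff, Finset.mem_union] at h3
          exact absurd (Or.inl hv) h3.2
        · exact Or.inr h
      · exact Finset.mem_union_left _ (Finset.mem_sdiff.2 ⟨Finset.mem_univ _, hvM⟩)
    have q1 := Finset.card_le_card hR
    have q2 := Finset.card_union_le (Finset.univ \ (MB ∪ M0 ∪ MJ).biUnion id) (gU J (J ∪ Q) (pR R a) n)
    have q3 := hgJ n
    omega

lemma bad_prob (r n d κ b b1 bD : ℕ) (hn : 2 ≤ n) (H1 : Finset (Finset (Fin n))) (hH1 : ∀ e ∈ H1, e.Nonempty)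
    (R : Finset (Fin n)) (hκ1 : 1 ≤ κ) (hκ : κ ≤ d)
    (hE1 : ∀ J : Finset (Fin n), b1 ≤ J.card → ∃ e ∈ H1, e ⊆ J)
    (hbD : (r+1+1+1) * (b + 1 + b1) ≤ bD) (hRb : 2 * ((r+1+1+1) * (b + b1)) ≤ R.card)
    (y : ℝ) (hy0 : 0 < y) (hy1 : y ≤ 1) (hy : (bD : ℝ) * (r+1) ≤ y * ((n:ℝ)-1)) (p0 : ℝ) (hp01 : p0 ≤ 1)
    (hp : p0 * ((n-1).choose (r+1) : ℝ) ≤ (R.card.choose (r+1) : ℝ)) :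
    (((Finset.univ : Finset (Picks (r+1+1) n d)).filter (fun a => ¬ GoodR H1 R a)).card : ℝ) ≤
      (n * (2 ^ κ * (1 - p0/2) ^ d) / (b+1) + 2 * n * (2 ^ d * y ^ κ)) * Fintype.card (Picks (r+1+1) n d) := by
  set Ω := Picks (r+1+1) n d
  set S0 := (Finset.univ : Finset Ω).filter (fun a => b + 1 ≤ (Bp R κ a).card)
  set S1 := fun v => (Finset.univ : Finset Ω).filter (fun a => hitEv κ bD v (D1 R κ v) a)
  set S2 := fun v => (Finset.univ : Finset Ω).filter (fun a => hitEv κ bD v (D2 H1 R κ v) a)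
  have hsub : (Finset.univ : Finset Ω).filter (fun a => ¬ GoodR H1 R a) ⊆
      S0 ∪ (Finset.univ.biUnion S1 ∪ Finset.univ.biUnion S2) := by
    intro a ha
    rw [Finset.mem_filter] at ha
    by_contra hcon
    apply ha.2
    simp only [Finset.mem_union, Finset.mem_biUnion, S0, S1, S2, Finset.mem_filter, Finset.mem_univ, true_and, not_or, not_exists] at hcon
    exact good_of H1 hH1 R κ bD b b1 a hκ1 hκ hE1 (by omega) hbD hRb hcon.2.1 hcon.2.2
  have c1 : ∀ v, ((S1 v).card : ℝ) ≤ (2 ^ d * y ^ κ) * Fintype.card Ω := by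
    intro v
    have := hit_prob r n d κ bD v hn (D1 R κ v) (fun a f => D1_update R κ v a f) y hy0 hy1 hy
    refine le_trans (Nat.cast_le.2 (Finset.card_le_card ?_)) this
    intro a h
    exact Finset.mem_filter.2 (Finset.mem_filter.1 h)
  have c2 : ∀ v, ((S2 v).card : ℝ) ≤ (2 ^ d * y ^ κ) * Fintype.card Ω := by
    intro v
    have := hit_prob r n d κ bD v hn (D2 H1 R κ v) (fun a f => D2_update H1 R κ v a f) y hy0 hy1 hy
    refine le_trans (Nat.cast_le.2 (Finset.card_le_card ?_)) this
    intro a h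
    exact Finset.mem_filter.2 (Finset.mem_filter.1 h)
  have c1' : ((Finset.univ.biUnion S1).card : ℝ) ≤ n * ((2 ^ d * y ^ κ) * Fintype.card Ω) := by
    have h1 : ((Finset.univ.biUnion S1).card : ℝ) ≤ ∑ v, ((S1 v).card : ℝ) := by exact_mod_cast Finset.card_biUnion_le
    refine h1.trans ((Finset.sum_le_sum (fun v _ => c1 v)).trans (le_of_eq ?_))
    rw [Finset.sum_const, nsmul_eq_mul, Finset.card_univ, Fintype.card_fin]
  have c2' : ((Finset.univ.biUnion S2).card : ℝ) ≤ n * ((2 ^ d * y ^ κ) * Fintype.card Ω) := by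
    have h1 : ((Finset.univ.biUnion S2).card : ℝ) ≤ ∑ v, ((S2 v).card : ℝ) := by exact_mod_cast Finset.card_biUnion_le
    refine h1.trans ((Finset.sum_le_sum (fun v _ => c2 v)).trans (le_of_eq ?_))
    rw [Finset.sum_const, nsmul_eq_mul, Finset.card_univ, Fintype.card_fin]
  have hPnn : 0 ≤ (2 ^ κ * (1 - p0/2) ^ d) * (Fintype.card Ω : ℝ) := by
    have : 0 ≤ 1 - p0/2 := by linarith
    positivity
  have c0 : (S0.card : ℝ) * (b+1) ≤ n * ((2 ^ κ * (1 - p0/2) ^ d) * Fintype.card Ω) := by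
    have h1 : S0.card * (b+1) ≤ ∑ a : Ω, (Bp R κ a).card := by
      rw [← smul_eq_mul, ← Finset.sum_const]
      refine (Finset.sum_le_sum (fun a ha => (Finset.mem_filter.1 ha).2)).trans ?_
      exact Finset.sum_le_sum_of_subset (Finset.subset_univ _)
    have h2 : ∑ a : Ω, (Bp R κ a).card = ∑ v : Fin n, ((Finset.univ : Finset Ω).filter (fun a => v ∈ Bp R κ a)).card := by
      simp_rw [Finset.card_filter]
      rw [Finset.sum_comm]
      apply Finset.sum_congr rfl
      intro a _
      rw [← Finset.card_filter]
      congr 1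
      ext v; simp
    have h3 : ∀ v : Fin n, (((Finset.univ : Finset Ω).filter (fun a => v ∈ Bp R κ a)).card : ℝ) ≤ (2 ^ κ * (1 - p0/2) ^ d) * Fintype.card Ω := by
      intro v
      by_cases hv : v ∈ R
      · rw [Finset.filter_false_of_mem]
        · simpa using hPnn
        · intro a _ h
          unfold Bp at h
          rw [Finset.mem_filter] at h
          exact h.2.1 hv
      · refine le_trans ?_ (poor_prob r n d κ v R hv p0 hp)
        norm_cast
        apply Finset.card_le_card
        intro a ha
        rw [Finset.mem_filter] at ha ⊢
        refine ⟨Finset.mem_univ _, ?_⟩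
        have := ha.2
        unfold Bp at this
        exact (Finset.mem_filter.1 this).2.2
    rw [h2] at h1
    have h4 : (S0.card : ℝ) * (b+1) ≤ ∑ v : Fin n, (((Finset.univ : Finset Ω).filter (fun a => v ∈ Bp R κ a)).card : ℝ) := by exact_mod_cast h1
    refine h4.trans ((Finset.sum_le_sum (fun v _ => h3 v)).trans (le_of_eq ?_))
    rw [Finset.sum_const, nsmul_eq_mul, Finset.card_univ, Fintype.card_fin]
  have c0' : (S0.card : ℝ) ≤ n * ((2 ^ κ * (1 - p0/2) ^ d) * Fintype.card Ω) / (b+1) := by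
    rw [le_div_iff₀ (by positivity)]; exact c0
  have hfin := Finset.card_le_card hsub
  have h5 := Finset.card_union_le S0 (Finset.univ.biUnion S1 ∪ Finset.univ.biUnion S2)
  have h6 := Finset.card_union_le (Finset.univ.biUnion S1) (Finset.univ.biUnion S2)
  have h7 : (((Finset.univ : Finset Ω).filter (fun a => ¬ GoodR H1 R a)).card : ℝ) ≤
      S0.card + ((Finset.univ.biUnion S1).card + (Finset.univ.biUnion S2).card) := by
    exact_mod_cast hfin.trans (h5.trans (by omega))
  refine h7.trans ((add_le_add c0' (add_le_add c1' c2')).trans (le_of_eq ?_))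
  ring

lemma E1_prob (k n m b1 : ℕ) (θ : ℝ) (hθ1 : θ ≤ 1) (hθ : θ * (n.choose k : ℝ) ≤ (b1.choose k : ℝ)) (hk : k ≤ n) :
    ((((allEdges k n).powersetCard m).filter (fun H1 => ¬ ∀ J : Finset (Fin n), b1 ≤ J.card → ∃ e ∈ H1, e ⊆ J)).card : ℝ) ≤
      2 ^ n * (1 - θ) ^ m * ((allEdges k n).card.choose m : ℝ) := by
  have hN : (allEdges k n).card = n.choose k := by unfold allEdges; simp
  set N := (allEdges k n).card with hNd
  have hN0 : 0 < N := by rw [hN]; exact Nat.choose_pos hk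
  have hsub : ((allEdges k n).powersetCard m).filter (fun H1 => ¬ ∀ J : Finset (Fin n), b1 ≤ J.card → ∃ e ∈ H1, e ⊆ J) ⊆
      ((Finset.univ : Finset (Finset (Fin n))).filter (fun J => b1 ≤ J.card)).biUnion
        (fun J => (allEdges k n \ J.powersetCard k).powersetCard m) := by
    intro H hH
    rw [Finset.mem_filter, Finset.mem_powersetCard] at hH
    obtain ⟨⟨h1, h2⟩, h3⟩ := hH
    push Not at h3
    obtain ⟨J, hJ, hJ2⟩ := h3
    rw [Finset.mem_biUnion]
    refine ⟨J, by simpa using hJ, ?_⟩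
    rw [Finset.mem_powersetCard]
    refine ⟨?_, h2⟩
    intro e he
    rw [Finset.mem_sdiff]
    exact ⟨h1 he, fun h => hJ2 e he (Finset.mem_powersetCard.1 h).1⟩
  have hone : ∀ J ∈ (Finset.univ : Finset (Finset (Fin n))).filter (fun J => b1 ≤ J.card),
      (((allEdges k n \ J.powersetCard k).powersetCard m).card : ℝ) ≤ (1 - θ) ^ m * (N.choose m : ℝ) := by
    intro J hJ
    have hJ' : b1 ≤ J.card := (Finset.mem_filter.1 hJ).2
    have hss : J.powersetCard k ⊆ allEdges k n := Finset.powersetCard_mono (Finset.subset_univ _)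
    rw [Finset.card_powersetCard]
    set A := (allEdges k n \ J.powersetCard k).card with hA
    have hAle : A ≤ N := Finset.card_le_card Finset.sdiff_subset
    have hAadd : A + J.card.choose k = N := by
      rw [hA, Finset.card_sdiff_of_subset hss, Finset.card_powersetCard]
      have := Finset.card_le_card hss
      rw [Finset.card_powersetCard] at this
      omega
    have hA2 : (A:ℝ) ≤ (1 - θ) * N := by
      have h1 : (A:ℝ) + J.card.choose k = N := by exact_mod_cast hAadd
      have h2 : (b1.choose k : ℝ) ≤ J.card.choose k := by exact_mod_cast Nat.choose_le_choose k hJ'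
      rw [← hN] at hθ
      linarith
    have hr := choose_ratio A N m hAle
    have hr' : (A.choose m : ℝ) * (N:ℝ)^m ≤ N.choose m * (A:ℝ)^m := by exact_mod_cast hr
    have hNm : (0:ℝ) < (N:ℝ)^m := by positivity
    apply le_of_mul_le_mul_right _ hNm
    refine hr'.trans ?_
    calc (N.choose m : ℝ) * (A:ℝ)^m ≤ N.choose m * ((1 - θ) * N)^m := by gcongr
      _ = _ := by rw [mul_pow]; ring
  have h1 := (Finset.card_le_card hsub).trans Finset.card_biUnion_le
  have h2 : ((((allEdges k n).powersetCard m).filter (fun H1 => ¬ ∀ J : Finset (Fin n), b1 ≤ J.card → ∃ e ∈ H1, e ⊆ J)).card : ℝ) ≤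
      ∑ J ∈ (Finset.univ : Finset (Finset (Fin n))).filter (fun J => b1 ≤ J.card), (((allEdges k n \ J.powersetCard k).powersetCard m).card : ℝ) := by
    exact_mod_cast h1
  refine h2.trans ((Finset.sum_le_sum hone).trans ?_)
  rw [Finset.sum_const, nsmul_eq_mul, mul_assoc]
  have h3 : 0 ≤ (1 - θ) ^ m * (N.choose m : ℝ) := by
    have : 0 ≤ 1 - θ := by linarith
    positivity
  apply mul_le_mul_of_nonneg_right _ h3
  have : ((Finset.univ : Finset (Finset (Fin n))).filter (fun J => b1 ≤ J.card)).card ≤ 2 ^ n := by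
    refine (Finset.card_filter_le _ _).trans ?_
    simp
  exact_mod_cast this

lemma markov_half {α β : Type*} (A : Finset α) (B : Finset β) (bad : α → β → Prop) (η : ℝ) (hη : 0 ≤ η)
    (h : ∀ R ∈ B, ((A.filter (fun a => bad a R)).card : ℝ) ≤ η * A.card) :
    ((A.filter (fun a => 2 * (B.filter (fun R => ¬ bad a R)).card < B.card)).card : ℝ) ≤ 2 * η * A.card := by
  set S := A.filter (fun a => 2 * (B.filter (fun R => ¬ bad a R)).card < B.card) with hS
  rcases Finset.eq_empty_or_nonempty S with h0 | ⟨a0, ha0⟩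
  · rw [h0]
    simp only [Finset.card_empty, Nat.cast_zero]
    positivity
  have hBpos : (0:ℝ) < B.card := by
    have := (Finset.mem_filter.1 ha0).2
    exact_mod_cast (by omega : 0 < B.card)
  have h1 : ∀ a ∈ S, (B.card : ℝ) ≤ 2 * (B.filter (fun R => bad a R)).card := by
    intro a ha
    have h2 := (Finset.mem_filter.1 ha).2
    have h3 := Finset.card_filter_add_card_filter_not (s := B) (fun R => bad a R)
    exact_mod_cast (by omega)
  have h4 : (S.card : ℝ) * B.card ≤ 2 * ∑ a ∈ A, ((B.filter (fun R => bad a R)).card : ℝ) := by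
    rw [← nsmul_eq_mul, ← Finset.sum_const, Finset.mul_sum]
    refine (Finset.sum_le_sum h1).trans ?_
    apply Finset.sum_le_sum_of_subset_of_nonneg (Finset.filter_subset _ _)
    intros; positivity
  have h5 : ∑ a ∈ A, ((B.filter (fun R => bad a R)).card : ℝ) = ∑ R ∈ B, ((A.filter (fun a => bad a R)).card : ℝ) := by
    norm_cast
    simp_rw [Finset.card_filter]
    rw [Finset.sum_comm]
  rw [h5] at h4
  have h6 := h4.trans (mul_le_mul_of_nonneg_left (Finset.sum_le_sum h) (by norm_num : (0:ℝ) ≤ 2))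
  rw [Finset.sum_const, nsmul_eq_mul] at h6
  apply le_of_mul_le_mul_right _ hBpos
  linarith

lemma uniform_card {V : Type*} [DecidableEq V] {k : ℕ} (M : Finset (Finset V)) (hk : ∀ e ∈ M, e.card = k)
    (hd : ∀ e ∈ M, ∀ f ∈ M, e ≠ f → Disjoint e f) : (M.biUnion id).card = k * M.card := by
  rw [Finset.card_biUnion (t := id) (fun e he f hf hne => hd e he f hf hne)]
  rw [Finset.sum_const_nat (m := k), mul_comm]
  intro e he; exact hk e he

lemma inner_count (r n d s l w : ℕ) (hs0 : 0 < s) (hs : s ≤ n) (hdiv : (r+1+1) ∣ n) (a : Picks (r+1+1) n d)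
    (H1 : Finset (Finset (Fin n))) (hH1 : H1 ⊆ allEdges (r+1+1) n)
    (hhalf : ¬ 2 * (((Finset.univ : Finset (Fin n)).powersetCard s).filter (fun R => ¬ ¬ GoodR H1 R a)).card < ((Finset.univ : Finset (Fin n)).powersetCard s).card)
    (hw : 0 < w) (x : ℝ) (hx0 : 0 ≤ x) (hx : x ≤ 1/2)
    (hl : n < 2 ^ l)
    (hq : ((allEdges (r+1+1) n).card : ℝ) * (((s:ℝ)/n)^(r+1+1) * (2*((r+1:ℕ)+1)*Real.exp 1 / s)^(r+1)) ≤ (x/2)^2 * w) :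
    ((((allEdges (r+1+1) n \ H1).powersetCard (l*w)).filter
      (fun C => ¬ HasPerfectMatching (r+1+1) n (edgesOf a ∪ (H1 ∪ C)))).card : ℝ) ≤
      4 * x * ((allEdges (r+1+1) n \ H1).card.choose (l*w) : ℝ) := by
  set Good := ((Finset.univ : Finset (Fin n)).powersetCard s).filter (fun R => GoodR H1 R a) with hGood
  have hex : ∀ R : Finset (Fin n), ∃ M : Finset (Finset (Fin n)), GoodR H1 R a → (M ⊆ edgesOf a ∪ H1 ∧ (∀ e ∈ M, ∀ f ∈ M, e ≠ f → Disjoint e f) ∧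
    Finset.univ \ M.biUnion id ⊆ R ∧ R.card ≤ 2 * (Finset.univ \ M.biUnion id).card) := by
    intro R
    by_cases h : GoodR H1 R a
    · obtain ⟨M, hM⟩ := h
      exact ⟨M, fun _ => hM⟩
    · exact ⟨∅, fun h' => absurd h' h⟩
  choose M hM using hex
  have hcard : ∀ e ∈ edgesOf a ∪ H1, e.card = (r+1+1) := by
    intro e he
    rcases Finset.mem_union.1 he with he | he
    · unfold edgesOf at he
      obtain ⟨v, _, h2⟩ := Finset.mem_biUnion.1 he
      obtain ⟨j, _, rfl⟩ := Finset.mem_image.1 h2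
      exact (a v j).2.1
    · exact (Finset.mem_powersetCard.1 (hH1 he)).2
  have hUcard : ∀ R ∈ Good, (Finset.univ \ (M R).biUnion id).card + (r+1+1) * (M R).card = n := by
    intro R hR
    have hg := hM R (Finset.mem_filter.1 hR).2
    have h1 := uniform_card (M R) (fun e he => hcard e (hg.1 he)) hg.2.1
    rw [← h1, Finset.card_sdiff_add_card_eq_card (Finset.subset_univ _)]
    simp
  have key := spread_apply (r+1) n s (Nat.succ_pos r) hs0 hs H1 Good (Finset.filter_subset _ _)
    (fun R => Finset.univ \ (M R).biUnion id)
    (fun R hR => (hM R (Finset.mem_filter.1 hR).2).2.2.1)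
    (fun R hR => by
      have := (hM R (Finset.mem_filter.1 hR).2).2.2.2
      rwa [(Finset.mem_powersetCard.1 (Finset.mem_filter.1 hR).1).2] at this)
    (fun R hR => by
      have := hUcard R hR
      have h2 : (r+1+1) ∣ (Finset.univ \ (M R).biUnion id).card + (r+1+1) * (M R).card := by rw [this]; exact hdiv
      exact (Nat.dvd_add_left (dvd_mul_right _ _)).1 h2) l w hw x hx0 hx hl hq
  have hG : (1:ℝ)/2 ≤ Good.card / (n.choose s : ℝ) := by
    have hpos : (0:ℝ) < n.choose s := by exact_mod_cast Nat.choose_pos hs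
    rw [div_le_div_iff₀ (by norm_num) hpos]
    have h1 : (((Finset.univ : Finset (Fin n)).powersetCard s).filter (fun R => ¬ ¬ GoodR H1 R a)) = Good := by
      rw [hGood]
      ext R
      simp only [Finset.mem_filter, not_not]
    rw [h1, Finset.card_powersetCard, Finset.card_univ, Fintype.card_fin] at hhalf
    push Not at hhalf
    have : (n.choose s : ℝ) ≤ 2 * Good.card := by exact_mod_cast hhalf
    linarith
  have hle : (((allEdges (r+1+1) n \ H1).powersetCard (l*w)).filter
      (fun C => ¬ HasPerfectMatching (r+1+1) n (edgesOf a ∪ (H1 ∪ C)))).card ≤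
      (((allEdges (r+1+1) n \ H1).powersetCard (l*w)).filter
      (fun C => ∀ R ∈ Good, ∀ T ∈ PMs (r+1+1) (Finset.univ \ (M R).biUnion id), ¬ T \ H1 ⊆ C)).card := by
    apply Finset.card_le_card
    intro C hC
    rw [Finset.mem_filter] at hC ⊢
    refine ⟨hC.1, ?_⟩
    intro R hR T hT hTC
    apply hC.2
    have hg := hM R (Finset.mem_filter.1 hR).2
    have hc := hUcard R hR
    have hTc := PMs_card hT
    rw [mem_PMs] at hT
    obtain ⟨t1, t2, t3⟩ := hT
    have hcross : ∀ e ∈ M R, ∀ f ∈ T, Disjoint e f := by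
      intro e he f hf
      refine Disjoint.mono (Finset.subset_biUnion_of_mem id he) (t1 f hf).1 ?_
      exact Finset.disjoint_sdiff
    have hdj : ∀ e ∈ M R ∪ T, ∀ f ∈ M R ∪ T, e ≠ f → Disjoint e f := by
      intro e he f hf hne
      rcases Finset.mem_union.1 he with he | he <;> rcases Finset.mem_union.1 hf with hf | hf
      · exact hg.2.1 e he f hf hne
      · exact hcross e he f hf
      · exact (hcross f hf e he).symm
      · exact t2 e he f hf hne
    have hcov : (M R ∪ T).biUnion id = Finset.univ := by
      rw [Finset.union_biUnion, t3]
      exact Finset.union_sdiff_of_subset (Finset.subset_univ _)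
    refine ⟨M R ∪ T, ?_, ?_, hdj, hcov⟩
    · intro e he
      rcases Finset.mem_union.1 he with he | he
      · rcases Finset.mem_union.1 (hg.1 he) with h | h
        · exact Finset.mem_union_left _ h
        · exact Finset.mem_union_right _ (Finset.mem_union_left _ h)
      · apply Finset.mem_union_right
        by_cases h : e ∈ H1
        · exact Finset.mem_union_left _ h
        · exact Finset.mem_union_right _ (hTC (Finset.mem_sdiff.2 ⟨he, h⟩))
    · have h1 := uniform_card (M R ∪ T) (k := r+1+1) (by
        intro e he
        rcases Finset.mem_union.1 he with he | he
        · exact hcard e (hg.1 he)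
        · exact (t1 e he).2) hdj
      rw [hcov, Finset.card_univ, Fintype.card_fin] at h1
      exact (Nat.div_eq_of_eq_mul_right (by omega) h1).symm
  have hle' : ((((allEdges (r+1+1) n \ H1).powersetCard (l*w)).filter
      (fun C => ¬ HasPerfectMatching (r+1+1) n (edgesOf a ∪ (H1 ∪ C)))).card : ℝ) ≤
      (((allEdges (r+1+1) n \ H1).powersetCard (l*w)).filter
      (fun C => ∀ R ∈ Good, ∀ T ∈ PMs (r+1+1) (Finset.univ \ (M R).biUnion id), ¬ T \ H1 ⊆ C)).card := by exact_mod_cast hle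
  have h3 := mul_le_mul_of_nonneg_left hG (Nat.cast_nonneg (α := ℝ) (((allEdges (r+1+1) n \ H1).powersetCard (l*w)).filter
      (fun C => ∀ R ∈ Good, ∀ T ∈ PMs (r+1+1) (Finset.univ \ (M R).biUnion id), ¬ T \ H1 ⊆ C)).card)
  have h4 := h3.trans key
  linarith

theorem main_count (r n d κ b b1 bD s l w m1 : ℕ) (hn : 2 ≤ n) (hkn : r+1+1 ≤ n) (hdiv : (r+1+1) ∣ n)
    (hs0 : 0 < s) (hs : s ≤ n) (hw : 0 < w) (hl : n < 2 ^ l)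
    (hκ1 : 1 ≤ κ) (hκ : κ ≤ d) (hbD : (r+1+1+1) * (b + 1 + b1) ≤ bD) (hRb : 2 * ((r+1+1+1) * (b + b1)) ≤ s)
    (x y p0 θ : ℝ) (hx0 : 0 ≤ x) (hx : x ≤ 1/2)
    (hq : ((allEdges (r+1+1) n).card : ℝ) * (((s:ℝ)/n)^(r+1+1) * (2*((r+1:ℕ)+1)*Real.exp 1 / s)^(r+1)) ≤ (x/2)^2 * w)
    (hy0 : 0 < y) (hy1 : y ≤ 1) (hy : (bD : ℝ) * (r+1) ≤ y * ((n:ℝ)-1)) (hp01 : p0 ≤ 1)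
    (hp : p0 * ((n-1).choose (r+1) : ℝ) ≤ (s.choose (r+1) : ℝ))
    (hθ1 : θ ≤ 1) (hθ : θ * (n.choose (r+1+1) : ℝ) ≤ (b1.choose (r+1+1) : ℝ))
    (hm : m1 + l * w ≤ n.choose (r+1+1)) :
    1 - (2 ^ n * (1 - θ) ^ m1 + 2 * (n * (2 ^ κ * (1 - p0/2) ^ d) / (b+1) + 2 * n * (2 ^ d * y ^ κ)) + 4 * x) ≤
    pr ((Finset.univ : Finset (Picks (r+1+1) n d)) ×ˢ (allEdges (r+1+1) n).powersetCard (m1 + l * w))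
      (fun ab => HasPerfectMatching (r+1+1) n (edgesOf ab.1 ∪ ab.2)) := by
  set Ω := Picks (r+1+1) n d with hΩ
  set X := allEdges (r+1+1) n with hX
  have hN : X.card = n.choose (r+1+1) := by rw [hX]; unfold allEdges; simp
  set η := (n * (2 ^ κ * (1 - p0/2) ^ d) / ((b:ℝ)+1) + 2 * n * (2 ^ d * y ^ κ)) with hη
  have hη0 : 0 ≤ η := by
    have : 0 ≤ 1 - p0/2 := by linarith
    positivity
  set pE := 2 ^ n * (1 - θ) ^ m1 with hpE
  set T : ℝ := ((X.card - m1).choose (l*w) : ℝ) with hT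
  set E1 : Finset (Finset (Fin n)) → Prop := fun H1 => ∀ J : Finset (Fin n), b1 ≤ J.card → ∃ e ∈ H1, e ⊆ J with hE1
  set bad : Ω → Finset (Finset (Fin n)) → Prop := fun a W =>
    2 * (((Finset.univ : Finset (Fin n)).powersetCard s).filter (fun R => ¬ ¬ GoodR W R a)).card < ((Finset.univ : Finset (Fin n)).powersetCard s).card with hbad
  set cnt : Ω → Finset (Finset (Fin n)) → ℝ := fun a W => ((((X \ W).powersetCard (l*w)).filter
      (fun C => ¬ HasPerfectMatching (r+1+1) n (edgesOf a ∪ (W ∪ C)))).card : ℝ) with hcnt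
  have hT0 : 0 ≤ T := Nat.cast_nonneg _
  have hXW : ∀ W ∈ X.powersetCard m1, (X \ W).card = X.card - m1 := by
    intro W hW
    rw [Finset.mem_powersetCard] at hW
    rw [Finset.card_sdiff_of_subset hW.1, hW.2]
  have hcntT : ∀ a, ∀ W ∈ X.powersetCard m1, cnt a W ≤ T := by
    intro a W hW
    simp only [hcnt]
    rw [hT, ← hXW W hW, ← Finset.card_powersetCard]
    exact_mod_cast Finset.card_filter_le _ _
  -- per W bound
  have hW1 : ∀ W ∈ X.powersetCard m1, E1 W → ∑ a : Ω, cnt a W ≤ (2 * η + 4 * x) * T * Fintype.card Ω := by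
    intro W hW hE
    have hWX := (Finset.mem_powersetCard.1 hW).1
    have hmk := markov_half (Finset.univ : Finset Ω) ((Finset.univ : Finset (Fin n)).powersetCard s) (fun a R => ¬ GoodR W R a) η hη0 (by
      intro R hR
      have hRs := (Finset.mem_powersetCard.1 hR).2
      have := bad_prob r n d κ b b1 bD hn W (by
        intro e he
        have := (Finset.mem_powersetCard.1 (hWX he)).2
        rw [← Finset.card_pos]; omega) R hκ1 hκ hE hbD (by rw [hRs]; exact hRb) y hy0 hy1 hy p0 hp01 (by rw [hRs]; exact hp)
      rw [Finset.card_univ]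
      convert this)
    have hb : ∀ a, cnt a W ≤ (if bad a W then T else 0) + 4 * x * T := by
      intro a
      have h4 : 0 ≤ 4 * x * T := by positivity
      split_ifs with h
      · have := hcntT a W hW
        linarith
      · have := inner_count r n d s l w hs0 hs hdiv a W hWX h hw x hx0 hx hl hq
        rw [← hX, hXW W hW] at this
        rw [zero_add]
        exact this
    refine (Finset.sum_le_sum (fun a _ => hb a)).trans ?_
    rw [Finset.sum_add_distrib, ← Finset.sum_filter, Finset.sum_const, Finset.sum_const, nsmul_eq_mul, nsmul_eq_mul]
    rw [Finset.card_univ] at hmk ⊢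
    have := mul_le_mul_of_nonneg_right hmk hT0
    calc _ ≤ 2 * η * (Fintype.card Ω) * T + (Fintype.card Ω) * (4 * x * T) := by
          refine add_le_add ?_ le_rfl
          convert this
          rfl
      _ = _ := by ring
  have hW2 : ∀ W ∈ X.powersetCard m1, ∑ a : Ω, cnt a W ≤ (if ¬ E1 W then T * Fintype.card Ω else 0) + (2 * η + 4 * x) * T * Fintype.card Ω := by
    intro W hW
    have hnn : 0 ≤ (2 * η + 4 * x) * T * (Fintype.card Ω : ℝ) := by positivity
    by_cases h : ¬ E1 W
    · rw [if_pos h]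
      refine le_trans (Finset.sum_le_sum (fun a _ => hcntT a W hW)) ?_
      rw [Finset.sum_const, nsmul_eq_mul, Finset.card_univ]
      nlinarith
    · rw [if_neg h, zero_add]
      exact hW1 W hW (not_not.1 h)
  have hE := E1_prob (r+1+1) n m1 b1 θ hθ1 hθ hkn
  have htot : ∑ W ∈ X.powersetCard m1, ∑ a : Ω, cnt a W ≤ (pE + 2 * η + 4 * x) * (X.card.choose m1 * T) * Fintype.card Ω := by
    refine (Finset.sum_le_sum hW2).trans ?_
    rw [Finset.sum_add_distrib, ← Finset.sum_filter, Finset.sum_const, Finset.sum_const, nsmul_eq_mul, nsmul_eq_mul, Finset.card_powersetCard]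
    have h1 := mul_le_mul_of_nonneg_right hE (show 0 ≤ T * (Fintype.card Ω : ℝ) by positivity)
    calc _ ≤ pE * (X.card.choose m1 : ℝ) * (T * (Fintype.card Ω : ℝ)) + (X.card.choose m1 : ℝ) * ((2 * η + 4 * x) * T * Fintype.card Ω) := by
          refine add_le_add ?_ le_rfl
          convert h1
      _ = _ := by ring
  -- relate to fail count
  set S := (Finset.univ : Finset Ω) ×ˢ X.powersetCard (m1 + l*w) with hS
  have hfail : ((S.filter (fun ab => ¬ HasPerfectMatching (r+1+1) n (edgesOf ab.1 ∪ ab.2))).card : ℝ) * ((m1 + l*w).choose m1 : ℝ) =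
      ∑ W ∈ X.powersetCard m1, ∑ a : Ω, cnt a W := by
    have h1 : (S.filter (fun ab => ¬ HasPerfectMatching (r+1+1) n (edgesOf ab.1 ∪ ab.2))).card =
        ∑ a : Ω, ((X.powersetCard (m1 + l*w)).filter (fun C => ¬ HasPerfectMatching (r+1+1) n (edgesOf a ∪ C))).card := by
      rw [hS]
      simp_rw [Finset.card_filter]
      rw [Finset.sum_product]
    rw [h1, Finset.sum_comm]
    push_cast
    rw [Finset.sum_mul]
    apply Finset.sum_congr rfl
    intro a _
    have := split_count X m1 (l*w) (fun C => ¬ HasPerfectMatching (r+1+1) n (edgesOf a ∪ C))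
    simp only [hcnt]
    norm_cast
    convert this
  have hchoose : (X.card.choose m1 : ℝ) * T = X.card.choose (m1 + l*w) * ((m1 + l*w).choose m1 : ℝ) := by
    have := Nat.choose_mul (n := X.card) (k := m1 + l*w) (s := m1) (by omega)
    rw [Nat.add_sub_cancel_left] at this
    rw [hT]
    exact_mod_cast this.symm
  have hScard : (S.card : ℝ) = Fintype.card Ω * X.card.choose (m1 + l*w) := by
    rw [hS, Finset.card_product, Finset.card_univ, Finset.card_powersetCard]
    push_cast; rfl
  have hcp : (0:ℝ) < ((m1 + l*w).choose m1 : ℝ) := by exact_mod_cast Nat.choose_pos (by omega)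
  have hfail2 : ((S.filter (fun ab => ¬ HasPerfectMatching (r+1+1) n (edgesOf ab.1 ∪ ab.2))).card : ℝ) ≤
      (pE + 2 * η + 4 * x) * S.card := by
    apply le_of_mul_le_mul_right _ hcp
    rw [hfail]
    refine htot.trans (le_of_eq ?_)
    rw [hchoose, hScard]; ring
  have hSpos : (0:ℝ) < S.card := by
    rw [hScard]
    have h1 : 0 < X.card.choose (m1 + l*w) := Nat.choose_pos (by rw [hN]; exact hm)
    have h2 : Nonempty Ω := by
      refine ⟨fun v _ => ?_⟩
      have : 0 < Fintype.card {e : Finset (Fin n) // e.card = r+1+1 ∧ v ∈ e} := by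
        rw [star_card (r+1) n v]
        exact Nat.choose_pos (by omega)
      exact (Fintype.card_pos_iff.1 this).some
    have h3 : 0 < Fintype.card Ω := Fintype.card_pos
    positivity
  have hsum := Finset.card_filter_add_card_filter_not (s := S) (fun ab => HasPerfectMatching (r+1+1) n (edgesOf ab.1 ∪ ab.2))
  have hsum' : ((S.filter (fun ab => HasPerfectMatching (r+1+1) n (edgesOf ab.1 ∪ ab.2))).card : ℝ) +
      ((S.filter (fun ab => ¬ HasPerfectMatching (r+1+1) n (edgesOf ab.1 ∪ ab.2))).card : ℝ) = S.card := by exact_mod_cast hsum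
  unfold pr
  rw [le_div_iff₀ hSpos]
  have : ((S.filter (fun ab => HasPerfectMatching (r+1+1) n (edgesOf ab.1 ∪ ab.2))).card : ℝ) ≥ S.card - (pE + 2 * η + 4 * x) * S.card := by linarith
  calc _ = S.card - (pE + 2 * η + 4 * x) * S.card := by ring
    _ ≤ _ := this

lemma choose_lower (s j : ℕ) (h : 2 * j ≤ s) : ((s:ℝ)/2)^j ≤ (j.factorial : ℝ) * (s.choose j : ℝ) := by
  have h1 := Nat.pow_sub_le_descFactorial s j
  rw [Nat.descFactorial_eq_factorial_mul_choose] at h1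
  have h2 : (((s + 1 - j : ℕ) : ℝ))^j ≤ (j.factorial : ℝ) * (s.choose j : ℝ) := by exact_mod_cast h1
  refine le_trans (pow_le_pow_left₀ (by positivity) ?_ j) h2
  have h3 : s ≤ 2 * (s + 1 - j) := by omega
  have h4 : (s:ℝ) ≤ 2 * ((s + 1 - j : ℕ) : ℝ) := by exact_mod_cast h3
  linarith

lemma choose_upper (n j : ℕ) : (j.factorial : ℝ) * (n.choose j : ℝ) ≤ (n:ℝ)^j := by
  have h1 := Nat.descFactorial_le_pow n j
  rw [Nat.descFactorial_eq_factorial_mul_choose] at h1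
  exact_mod_cast h1

lemma choose_cmp (n s j : ℕ) (δ : ℝ) (hδ : 0 ≤ δ) (h : 2 * j ≤ s) (hs : δ * n ≤ s) :
    (δ/2)^j * (n.choose j : ℝ) ≤ s.choose j := by
  have hf : (0:ℝ) < j.factorial := by exact_mod_cast Nat.factorial_pos j
  have h1 := choose_lower s j h
  have h2 := choose_upper n j
  have h3 : (δ/2)^j * (n:ℝ)^j ≤ ((s:ℝ)/2)^j := by
    rw [← mul_pow]
    apply pow_le_pow_left₀ (by positivity)
    linarith
  have h4 := mul_le_mul_of_nonneg_left h2 (show 0 ≤ (δ/2)^j by positivity)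
  apply le_of_mul_le_mul_left _ hf
  nlinarith

lemma q_bound (r n s : ℕ) (A : ℝ) (hn : 0 < n) (hs : 0 < s) (hA : 0 ≤ A) :
    (n.choose (r+1+1) : ℝ) * (((s:ℝ)/n)^(r+1+1) * (A / s)^(r+1)) ≤ s * A^(r+1) := by
  have hn' : (0:ℝ) < n := by exact_mod_cast hn
  have hs' : (0:ℝ) < s := by exact_mod_cast hs
  have h1 : (n.choose (r+1+1) : ℝ) ≤ (n:ℝ)^(r+1+1) := by exact_mod_cast Nat.choose_le_pow n (r+1+1)
  refine (mul_le_mul_of_nonneg_right h1 (by positivity)).trans (le_of_eq ?_)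
  rw [div_pow, div_pow]
  field_simp
  ring

lemma one_sub_pow_le (p : ℝ) (hp : p ≤ 1) (m : ℕ) : (1 - p)^m ≤ Real.exp (-(p * m)) := by
  have h : 1 - p ≤ Real.exp (-p) := by have := Real.add_one_le_exp (-p); linarith
  refine (pow_le_pow_left₀ (by linarith) h m).trans (le_of_eq ?_)
  rw [← Real.exp_nat_mul]; congr 1; ring

lemma two_pow_le_exp (m : ℕ) : (2:ℝ)^m ≤ Real.exp m := by
  have h : (2:ℝ) ≤ Real.exp 1 := by have := Real.add_one_le_exp (1:ℝ); linarith
  refine (pow_le_pow_left₀ (by norm_num) h m).trans (le_of_eq ?_)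
  rw [← Real.exp_nat_mul]; congr 1; ring

lemma two_pow_ceil (t : ℝ) (ht : 0 ≤ t) : (2:ℝ)^⌈t⌉₊ ≤ 2 * Real.exp t := by
  have h1 := Nat.ceil_lt_add_one ht
  have h2 : (2:ℝ)^⌈t⌉₊ = Real.exp (Real.log 2 * ⌈t⌉₊) := by
    rw [mul_comm, Real.exp_nat_mul, Real.exp_log (by norm_num)]
  rw [h2]
  have hl0 : 0 < Real.log 2 := Real.log_pos (by norm_num)
  have hl1 : Real.log 2 ≤ 1 := by have := Real.log_two_lt_d9; linarith
  have : (2:ℝ) * Real.exp t = Real.exp (Real.log 2 + t) := by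
    rw [Real.exp_add, Real.exp_log (by norm_num)]
  rw [this]
  apply Real.exp_le_exp.2
  nlinarith

lemma log_bound (n : ℕ) (hn : 1 ≤ n) (hL : 1 ≤ Real.log n) : ((Nat.log 2 n + 1 : ℕ) : ℝ) ≤ 3 * Real.log n := by
  have h1 : 2 ^ Nat.log 2 n ≤ n := Nat.pow_log_le_self 2 (by omega)
  have h2 : (2:ℝ) ^ Nat.log 2 n ≤ n := by exact_mod_cast h1
  have h3 := Real.log_le_log (by positivity) h2
  rw [Real.log_pow] at h3
  have := Real.log_two_gt_d9
  push_cast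
  nlinarith [Nat.cast_nonneg (α := ℝ) (Nat.log 2 n)]

lemma t1_bound (p c L : ℝ) (hp0 : 0 ≤ p) (hp1 : p ≤ 1) (e2 : ℝ) (he : 0 ≤ e2) (hc : c = p * e2 / 4) (hL : 0 ≤ L) :
    (2:ℝ)^⌈c * L⌉₊ * (1 - p/2)^⌈e2 * L⌉₊ ≤ 2 * Real.exp (-(c * L)) := by
  have hc0 : 0 ≤ c := by rw [hc]; positivity
  have h1 := two_pow_ceil (c*L) (by positivity)
  have h2 := one_sub_pow_le (p/2) (by linarith) ⌈e2 * L⌉₊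
  have h3 : Real.exp (-(p/2 * ⌈e2 * L⌉₊)) ≤ Real.exp (-(2 * (c * L))) := by
    apply Real.exp_le_exp.2
    have := Nat.le_ceil (e2 * L)
    rw [hc]; nlinarith
  calc _ ≤ (2 * Real.exp (c*L)) * Real.exp (-(2 * (c * L))) :=
        mul_le_mul h1 (h2.trans h3) (pow_nonneg (by linarith) _) (by positivity)
    _ = _ := by rw [mul_assoc, ← Real.exp_add]; congr 2; ring

lemma t2_bound (c e2 Y L : ℝ) (n : ℕ) (hn : 0 < n) (hL : L = Real.log n) (hL0 : 0 ≤ L) (hc : 0 < c) (he : 0 ≤ e2) (hY0 : 0 ≤ Y)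
    (hY : c * Y = 2 + e2) :
    2 * (n:ℝ) * ((2:ℝ)^⌈e2 * L⌉₊ * (Real.exp (-Y))^⌈c * L⌉₊) ≤ 4 * Real.exp (-L) := by
  have h1 := two_pow_ceil (e2*L) (by positivity)
  have h2 : (Real.exp (-Y))^⌈c * L⌉₊ ≤ Real.exp (-((2+e2) * L)) := by
    rw [← Real.exp_nat_mul]
    apply Real.exp_le_exp.2
    have := mul_le_mul_of_nonneg_right (Nat.le_ceil (c * L)) hY0
    rw [← hY]; nlinarith
  have h3 : (n:ℝ) = Real.exp L := by rw [hL, Real.exp_log (by exact_mod_cast hn)]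
  rw [h3]
  calc _ ≤ 2 * Real.exp L * ((2 * Real.exp (e2*L)) * Real.exp (-((2+e2) * L))) := by
        apply mul_le_mul_of_nonneg_left _ (by positivity)
        exact mul_le_mul h1 h2 (by positivity) (by positivity)
    _ = 4 * (Real.exp L * Real.exp (e2*L) * Real.exp (-((2+e2) * L))) := by ring
    _ = _ := by rw [← Real.exp_add, ← Real.exp_add]; congr 2; ring

lemma tE_bound (θ c1 L : ℝ) (n m : ℕ) (h0 : 0 ≤ θ) (h1 : θ ≤ 1) (hm : c1 * (n * L) ≤ m) (hL : 2 ≤ θ * c1 * L) :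
    (2:ℝ)^n * (1 - θ)^m ≤ Real.exp (-n) := by
  have h2 := two_pow_le_exp n
  have h3 := one_sub_pow_le θ h1 m
  calc _ ≤ Real.exp n * Real.exp (-(θ * m)) := mul_le_mul h2 h3 (pow_nonneg (by linarith) _) (by positivity)
    _ = Real.exp (n + -(θ * m)) := (Real.exp_add _ _).symm
    _ ≤ _ := by
      apply Real.exp_le_exp.2
      have h4 := mul_le_mul_of_nonneg_left hm h0
      have h5 := mul_le_mul_of_nonneg_right hL (Nat.cast_nonneg (α := ℝ) n)
      nlinarith

set_option maxHeartbeats 4000000 in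
theorem asym (r ρ : ℕ) (hρ : 1 ≤ ρ) (ε η : ℝ) (hε : 0 < ε) (hε1 : ε ≤ 1) (hη : 0 < η) :
    ∀ᶠ n : ℕ in Filter.atTop, (r+1+1) ∣ n →
    1 - η ≤ pr ((Finset.univ : Finset (Picks (r+1+1) n ⌈ε ^ 2 * Real.log n⌉₊)) ×ˢ
        (allEdges (r+1+1) n).powersetCard ⌊ε * n * Real.log n / ((r+1+1 : ℕ) * ρ)⌋₊)
      (fun ab => HasPerfectMatching (r+1+1) n (edgesOf ab.1 ∪ ab.2)) := by
  -- constants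
  obtain ⟨x, hx0, hx12, hxη⟩ : ∃ x : ℝ, 0 < x ∧ x ≤ 1/2 ∧ 4 * x ≤ η/4 :=
    ⟨min (1/2) (η/16), by positivity, min_le_left _ _, by have := min_le_right (1/2) (η/16); linarith⟩
  obtain ⟨A, hA⟩ : ∃ A : ℝ, A = 2*((r+1:ℕ)+1)*Real.exp 1 := ⟨_, rfl⟩
  have hA1 : 1 ≤ A := by
    have h : (2:ℝ) ≤ Real.exp 1 := by have := Real.add_one_le_exp (1:ℝ); linarith
    have h0 : (0:ℝ) ≤ (r+1:ℕ) := Nat.cast_nonneg _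
    rw [hA]; nlinarith
  have hAp : 1 ≤ A^(r+1) := one_le_pow₀ hA1
  obtain ⟨K, hK⟩ : ∃ K : ℝ, K = (r+1+1 : ℕ) * ρ := ⟨_, rfl⟩
  have hρ' : (1:ℝ) ≤ ρ := by exact_mod_cast hρ
  have hr0 : (0:ℝ) ≤ r := Nat.cast_nonneg _
  have hK1 : 1 ≤ K := by rw [hK]; push_cast; nlinarith
  obtain ⟨B, hB⟩ : ∃ B : ℝ, B = 16 * A^(r+1) / x^2 := ⟨_, rfl⟩
  have hBpos : 0 < B := by rw [hB]; positivity
  obtain ⟨δ, hδ0, hδ1, hδB⟩ : ∃ δ : ℝ, 0 < δ ∧ δ ≤ 1 ∧ 3 * B * δ ≤ ε / (4 * K) := by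
    refine ⟨min 1 (ε / (4*K) / (3 * B)), by positivity, min_le_left _ _, ?_⟩
    have := min_le_right 1 (ε / (4*K) / (3 * B))
    rw [le_div_iff₀ (by positivity)] at this
    linarith
  obtain ⟨p0, hp0⟩ : ∃ p0 : ℝ, p0 = (δ/2)^(r+1) := ⟨_, rfl⟩
  have hp0pos : 0 < p0 := by rw [hp0]; positivity
  have hp01 : p0 ≤ 1 := by rw [hp0]; exact pow_le_one₀ (by positivity) (by linarith)
  obtain ⟨c, hc⟩ : ∃ c : ℝ, c = p0 * ε^2 / 4 := ⟨_, rfl⟩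
  have hc0 : 0 < c := by rw [hc]; positivity
  have hcε : c ≤ ε^2 := by rw [hc]; nlinarith [sq_nonneg ε]
  obtain ⟨Y, hY⟩ : ∃ Y : ℝ, c * Y = 2 + ε^2 := ⟨(2+ε^2)/c, by field_simp⟩
  have hY0 : 0 ≤ Y := by
    by_contra h
    push Not at h
    nlinarith [sq_nonneg ε]
  obtain ⟨y, hy⟩ : ∃ y : ℝ, y = Real.exp (-Y) := ⟨_, rfl⟩
  have hy0 : 0 < y := by rw [hy]; positivity
  have hy1 : y ≤ 1 := by rw [hy]; exact Real.exp_le_one_iff.2 (by linarith)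
  obtain ⟨Q, hQ⟩ : ∃ Q : ℝ, Q = 8 * (r+1+1+1) * (r+1) := ⟨_, rfl⟩
  have hQ1 : 1 ≤ Q := by rw [hQ]; nlinarith
  obtain ⟨τ, hτ⟩ : ∃ τ : ℝ, τ * Q = y * δ := ⟨y * δ / Q, by field_simp⟩
  have hτ0 : 0 < τ := by
    have : 0 < τ * Q := by rw [hτ]; positivity
    exact pos_of_mul_pos_left this (by linarith)
  have hτδ : τ ≤ δ := by nlinarith
  obtain ⟨θ, hθ⟩ : ∃ θ : ℝ, θ = (τ/2)^(r+1+1) := ⟨_, rfl⟩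
  have hθ0 : 0 < θ := by rw [hθ]; positivity
  have hθ1 : θ ≤ 1 := by rw [hθ]; exact pow_le_one₀ (by positivity) (by linarith)
  obtain ⟨c1, hc1⟩ : ∃ c1 : ℝ, c1 = ε / (4 * K) := ⟨_, rfl⟩
  have hc10 : 0 < c1 := by rw [hc1]; positivity
  have hεK : ε / K = 4 * c1 := by rw [hc1]; field_simp
  obtain ⟨c2, hc2⟩ : ∃ c2 : ℝ, c2 = (1/2)^(r+1+1) / ((r+1+1).factorial : ℝ) := ⟨_, rfl⟩
  have hc20 : 0 < c2 := by rw [hc2]; positivity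
  -- eventual facts
  have hcast : Filter.Tendsto (fun n : ℕ => (n:ℝ)) Filter.atTop Filter.atTop := tendsto_natCast_atTop_atTop
  have hlog : Filter.Tendsto (fun n : ℕ => Real.log (n:ℝ)) Filter.atTop Filter.atTop := Real.tendsto_log_atTop.comp hcast
  have f1 := hcast.eventually_ge_atTop (2 * (r+1+1) / τ)
  have f2 := hlog.eventually_ge_atTop 1
  have f3 := hlog.eventually_ge_atTop (2 / (θ * c1))
  have f4 := hlog.eventually_ge_atTop (1 / (2 * c1))
  have f5 : ∀ᶠ n : ℕ in Filter.atTop, Real.log n ≤ c2 * n := by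
    have := hcast.eventually (Real.isLittleO_log_id_atTop.bound hc20)
    filter_upwards [this, f2] with n h1 h2
    simp only [id, Real.norm_eq_abs, Nat.abs_cast] at h1
    exact (le_abs_self _).trans h1
  have f6 : ∀ᶠ n : ℕ in Filter.atTop, 2 * Real.exp (-(c * Real.log n)) / τ ≤ η/8 := by
    have h1 : Filter.Tendsto (fun n : ℕ => Real.exp (-(c * Real.log n))) Filter.atTop (nhds 0) :=
      Real.tendsto_exp_neg_atTop_nhds_zero.comp (hlog.const_mul_atTop hc0)
    filter_upwards [h1.eventually_le_const (show 0 < η/8*τ/2 by positivity)] with n h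
    rw [div_le_iff₀ hτ0]; linarith
  have f7 : ∀ᶠ n : ℕ in Filter.atTop, 4 * Real.exp (-(Real.log n)) ≤ η/8 := by
    have h1 : Filter.Tendsto (fun n : ℕ => Real.exp (-(Real.log n))) Filter.atTop (nhds 0) :=
      Real.tendsto_exp_neg_atTop_nhds_zero.comp hlog
    filter_upwards [h1.eventually_le_const (show 0 < η/32 by positivity)] with n h
    linarith
  have f8 : ∀ᶠ n : ℕ in Filter.atTop, Real.exp (-(n:ℝ)) ≤ η/4 := by
    have h1 : Filter.Tendsto (fun n : ℕ => Real.exp (-(n:ℝ))) Filter.atTop (nhds 0) :=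
      Real.tendsto_exp_neg_atTop_nhds_zero.comp hcast
    exact h1.eventually_le_const (show 0 < η/4 by positivity)
  filter_upwards [f1, f2, f3, f4, f5, f6, f7, f8] with n f1 f2 f3 f4 f5 f6 f7 f8 hdiv
  rw [← hK]
  clear hcast hlog
  rw [div_le_iff₀ hτ0] at f1
  rw [div_le_iff₀ (by positivity)] at f3 f4
  obtain ⟨L, hL⟩ : ∃ L : ℝ, L = Real.log n := ⟨_, rfl⟩
  rw [← hL] at f2 f3 f4 f5 f6 f7 ⊢
  have hn0' : (0:ℝ) ≤ n := Nat.cast_nonneg n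
  have hnτ : τ * n ≤ δ * n := mul_le_mul_of_nonneg_right hτδ hn0'
  have hnδ : δ * n ≤ n := mul_le_of_le_one_left hn0' hδ1
  have hk2 : 2 * ((r+1+1 : ℕ) : ℝ) ≤ τ * n := by push_cast; linarith
  have hk2' : 2 * (r+1+1) ≤ n := by
    have : 2 * ((r+1+1 : ℕ) : ℝ) ≤ n := by linarith
    exact_mod_cast this
  have hnpos : 0 < n := by omega
  have hn1 : (1:ℝ) ≤ n := by exact_mod_cast hnpos
  have hτn1 : 1 ≤ τ * n := by push_cast at hk2; linarith
  obtain ⟨s, hs⟩ : ∃ s : ℕ, s = ⌈δ * n⌉₊ := ⟨_, rfl⟩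
  have hs1 : δ * n ≤ s := by rw [hs]; exact Nat.le_ceil _
  have hs2 : (s:ℝ) ≤ 2 * (δ * n) := by
    have := Nat.ceil_lt_add_one (show 0 ≤ δ * n by positivity)
    rw [← hs] at this; linarith
  have hsn : s ≤ n := by rw [hs]; exact Nat.ceil_le.2 hnδ
  have hs2k : 2 * (r+1+1) ≤ s := by
    have : 2 * ((r+1+1 : ℕ) : ℝ) ≤ s := by linarith
    exact_mod_cast this
  have hsr1 : (1:ℝ) ≤ s := by linarith
  obtain ⟨w, hw⟩ : ∃ w : ℕ, w = ⌈4 * A^(r+1) * s / x^2⌉₊ := ⟨_, rfl⟩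
  have hw1 : 4 * A^(r+1) * s / x^2 ≤ w := by rw [hw]; exact Nat.le_ceil _
  have hw2 : 1 ≤ 4 * A^(r+1) * s / x^2 := by
    rw [le_div_iff₀ (by positivity)]
    have h1 : x^2 ≤ 1 := pow_le_one₀ hx0.le (by linarith only [hx12])
    have h2 := one_le_mul_of_one_le_of_one_le hAp hsr1
    linarith only [h1, h2]
  have hw3 : (w:ℝ) ≤ B * (δ * n) := by
    have := Nat.ceil_lt_add_one (show 0 ≤ 4 * A^(r+1) * s / x^2 by positivity)
    rw [← hw] at this
    have h2 : 2 * (4 * A^(r+1) * s / x^2) ≤ B * (δ * n) := by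
      have : 2 * (4 * A^(r+1) * s / x^2) = B * (s/2) := by rw [hB]; ring
      rw [this]
      apply mul_le_mul_of_nonneg_left _ hBpos.le
      linarith
    linarith
  have hwpos : 0 < w := by
    have : (0:ℝ) < w := by linarith
    exact_mod_cast this
  obtain ⟨l, hl⟩ : ∃ l : ℕ, l = Nat.log 2 n + 1 := ⟨_, rfl⟩
  have hl1 : n < 2^l := by rw [hl]; exact Nat.lt_pow_succ_log_self (by norm_num) n
  have hl2 : (l:ℝ) ≤ 3 * L := by rw [hl, hL]; exact log_bound n hnpos (by rw [← hL]; exact f2)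
  have hlw : ((l * w : ℕ) : ℝ) ≤ c1 * (n * L) := by
    push_cast
    calc (l:ℝ) * w ≤ (3 * L) * (B * (δ * n)) := mul_le_mul hl2 hw3 (Nat.cast_nonneg _) (by linarith)
      _ = (3 * B * δ) * (n * L) := by ring
      _ ≤ c1 * (n * L) := by
        rw [hc1]
        exact mul_le_mul_of_nonneg_right hδB (by positivity)
  obtain ⟨m', hm'⟩ : ∃ m' : ℕ, m' = ⌊ε * n * L / K⌋₊ := ⟨_, rfl⟩
  rw [← hm']
  have hval : ε * n * L / K = 4 * c1 * (n * L) := by rw [← hεK]; ring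
  have hnL : 1 ≤ 2 * c1 * (n * L) := by
    have : L * (2 * c1) ≤ n * (L * (2 * c1)) := le_mul_of_one_le_left (by positivity) hn1
    linarith
  have hm1 : 2 * c1 * (n * L) ≤ m' := by
    have := Nat.lt_floor_add_one (ε * n * L / K)
    rw [← hm', hval] at this
    linarith
  have hm2 : (m':ℝ) ≤ n * L := by
    have := Nat.floor_le (show 0 ≤ ε * n * L / K by positivity)
    rw [← hm'] at this
    refine this.trans ?_
    rw [div_le_iff₀ (by linarith)]
    have h1 : 0 ≤ n * L := by positivity
    calc ε * n * L = ε * (n * L) := by ring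
      _ ≤ 1 * (n * L) := mul_le_mul_of_nonneg_right hε1 h1
      _ ≤ K * (n * L) := mul_le_mul_of_nonneg_right hK1 h1
      _ = _ := by ring
  obtain ⟨m1, hm1'⟩ : ∃ m1 : ℕ, m' = m1 + l * w := by
    refine ⟨m' - l*w, ?_⟩
    have : ((l*w : ℕ) : ℝ) ≤ m' := by
      have : 0 ≤ c1 * (n * L) := by positivity
      linarith
    have : l * w ≤ m' := by exact_mod_cast this
    omega
  have hm1L : c1 * (n * L) ≤ m1 := by
    have : (m':ℝ) = m1 + (l*w : ℕ) := by rw [hm1']; push_cast; ring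
    linarith
  have hmN : m' ≤ n.choose (r+1+1) := by
    have h1 := choose_lower n (r+1+1) hk2'
    have hf : (0:ℝ) < ((r+1+1).factorial : ℝ) := by exact_mod_cast Nat.factorial_pos _
    have h2 : c2 * (n:ℝ)^(r+1+1) ≤ n.choose (r+1+1) := by
      have : c2 * (n:ℝ)^(r+1+1) = ((n:ℝ)/2)^(r+1+1) / ((r+1+1).factorial : ℝ) := by
        rw [hc2, div_pow, div_pow, one_pow]; ring
      rw [this, div_le_iff₀ hf]; linarith
    have h3 : (n:ℝ)^2 ≤ (n:ℝ)^(r+1+1) := pow_le_pow_right₀ hn1 (by omega)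
    have : (m':ℝ) ≤ n.choose (r+1+1) := by
      calc (m':ℝ) ≤ n * L := hm2
        _ ≤ n * (c2 * n) := mul_le_mul_of_nonneg_left f5 hn0'
        _ = c2 * (n:ℝ)^2 := by ring
        _ ≤ _ := (mul_le_mul_of_nonneg_left h3 hc20.le).trans h2
    exact_mod_cast this
  obtain ⟨b, hb⟩ : ∃ b : ℕ, b = ⌊τ * n⌋₊ := ⟨_, rfl⟩
  obtain ⟨b1, hb1⟩ : ∃ b1 : ℕ, b1 = ⌈τ * n⌉₊ := ⟨_, rfl⟩
  have hbu : (b:ℝ) ≤ τ * n := by rw [hb]; exact Nat.floor_le (by positivity)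
  have hbl : τ * n ≤ (b:ℝ) + 1 := by rw [hb]; exact (Nat.lt_floor_add_one _).le
  have hb1l : τ * n ≤ b1 := by rw [hb1]; exact Nat.le_ceil _
  have hb1u : (b1:ℝ) ≤ τ * n + 1 := by rw [hb1]; exact (Nat.ceil_lt_add_one (by positivity)).le
  have hb12k : 2 * (r+1+1) ≤ b1 := by
    have : 2 * ((r+1+1 : ℕ) : ℝ) ≤ b1 := by linarith
    exact_mod_cast this
  have hbsum : (b:ℝ) + 1 + b1 ≤ 4 * (τ * n) := by linarith
  have hQn : τ * n * Q = y * (δ * n) := by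
    calc τ * n * Q = (τ * Q) * n := by ring
      _ = _ := by rw [hτ]; ring
  have hRb : 2 * ((r+1+1+1) * (b + b1)) ≤ s := by
    have : 2 * (((r:ℝ)+1+1+1) * (b + b1)) ≤ s := by
      have h1 : 2 * (((r:ℝ)+1+1+1) * (b + b1)) ≤ 2 * (((r:ℝ)+1+1+1) * (4 * (τ * n))) := by
        apply mul_le_mul_of_nonneg_left _ (by norm_num)
        apply mul_le_mul_of_nonneg_left _ (by positivity)
        linarith
      have h2 : 2 * (((r:ℝ)+1+1+1) * (4 * (τ * n))) ≤ τ * n * Q := by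
        rw [hQ]
        have : 0 ≤ (8 * ((r:ℝ)+1+1+1) * (τ * n)) * r := by positivity
        linarith only [this]
      have h3 : y * (δ * n) ≤ δ * n := mul_le_of_le_one_left (by positivity) hy1
      linarith
    exact_mod_cast this
  have hy' : (((r+1+1+1) * (b + 1 + b1) : ℕ) : ℝ) * (r+1) ≤ y * ((n:ℝ)-1) := by
    push_cast
    have h1 : (((r:ℝ)+1+1+1) * (b + 1 + b1)) * (r+1) ≤ (((r:ℝ)+1+1+1) * (4 * (τ * n))) * (r+1) := by
      apply mul_le_mul_of_nonneg_right _ (by positivity)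
      apply mul_le_mul_of_nonneg_left _ (by positivity)
      linarith
    have h2 : (((r:ℝ)+1+1+1) * (4 * (τ * n))) * (r+1) = τ * n * Q / 2 := by rw [hQ]; ring
    have h3 : y * (δ * n) ≤ y * n := mul_le_mul_of_nonneg_left hnδ hy0.le
    have h4 : (2:ℝ) ≤ n := by
      have : 2 ≤ n := by omega
      exact_mod_cast this
    have h5 : y * ((n:ℝ) / 2) ≤ y * (n - 1) := mul_le_mul_of_nonneg_left (by linarith) hy0.le
    linarith
  have hcardN : (allEdges (r+1+1) n).card = n.choose (r+1+1) := by unfold allEdges; simp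
  have hmain := main_count r n ⌈ε^2 * L⌉₊ ⌈c * L⌉₊ b b1 ((r+1+1+1) * (b + 1 + b1)) s l w m1 (by omega) (by omega) hdiv
    (by omega) hsn hwpos hl1 (Nat.ceil_pos.2 (by positivity))
    (Nat.ceil_mono (mul_le_mul_of_nonneg_right hcε (by linarith))) le_rfl hRb x y p0 θ hx0.le hx12
    (by
      rw [hcardN, ← hA]
      refine (q_bound r n s A hnpos (by omega) (by linarith)).trans ?_
      rw [div_le_iff₀ (by positivity)] at hw1
      linarith only [hw1])
    hy0 hy1 hy' hp01
    (by
      rw [hp0]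
      refine le_trans (mul_le_mul_of_nonneg_left ?_ (by positivity)) (choose_cmp n s (r+1) δ hδ0.le (by omega) hs1)
      exact_mod_cast Nat.choose_le_choose (r+1) (Nat.sub_le n 1))
    hθ1
    (by
      rw [hθ]
      exact choose_cmp n b1 (r+1+1) τ hτ0.le hb12k hb1l)
    (by rw [← hm1']; exact hmN)
  rw [hm1']
  refine le_trans ?_ hmain
  have e1 := tE_bound θ c1 L n m1 hθ0.le hθ1 hm1L (by linarith)
  have e2 := t1_bound p0 c L hp0pos.le hp01 (ε^2) (by positivity) hc (by linarith)
  have e3 := t2_bound c (ε^2) Y L n hnpos hL (by linarith) hc0 (by positivity) hY0 hY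
  rw [← hy] at e3
  have e4 : (n:ℝ) * (2 ^ ⌈c * L⌉₊ * (1 - p0/2) ^ ⌈ε^2 * L⌉₊) / (b+1) ≤ η/8 := by
    refine le_trans ?_ f6
    rw [div_le_div_iff₀ (by positivity) hτ0]
    have h1 := mul_le_mul_of_nonneg_left e2 (show 0 ≤ n * τ by positivity)
    have h2 := mul_le_mul_of_nonneg_left hbl (show 0 ≤ 2 * Real.exp (-(c*L)) by positivity)
    linarith
  linarith

/-- Let `r ≥ 3` with `r ∣ n`, let `ρ ≥ 1` be a fixed integer, and
let `ε > 0` be a sufficiently small constant; set `d* = ⌈ε² log n⌉` and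
`m' = ⌊ε n log n / (rρ)⌋`.  Let `Γ` be the union of an instance of `Ĥ_{n,d*}` and an
independent instance of `H_{n,m'}` (so the sample space is the product of the outcome
space of `Ĥ_{n,d*}`, with its uniform measure, and of the set of `m'`-element edge
sets, with its uniform measure: as both are uniform, the joint distribution is uniform
on the product).  Then, as `n → ∞` along multiples of `r`, the probability that `Γ`
contains a perfect matching tends to `1`. -/
theorem stmt_10 (r : ℕ) (hr : 3 ≤ r) (ρ : ℕ) (hρ : 1 ≤ ρ) :
    ∃ ε₀ : ℝ, 0 < ε₀ ∧ ∀ ε : ℝ, 0 < ε → ε ≤ ε₀ →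
      Filter.Tendsto
        (fun n : ℕ =>
          pr ((Finset.univ : Finset (Picks r n ⌈ε ^ 2 * Real.log n⌉₊)) ×ˢ
              (allEdges r n).powersetCard ⌊ε * n * Real.log n / (r * ρ)⌋₊)
            (fun ab => HasPerfectMatching r n (edgesOf ab.1 ∪ ab.2)))
        (Filter.atTop ⊓ Filter.principal {n : ℕ | r ∣ n}) (nhds 1) := by
  obtain ⟨r, rfl⟩ : ∃ r', r = r' + 1 + 1 := ⟨r - 2, by omega⟩
  refine ⟨1, one_pos, ?_⟩
  intro ε hε hε1
  rw [Metric.tendsto_nhds]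
  intro η hη
  rw [Filter.eventually_inf_principal]
  filter_upwards [asym r ρ hρ ε (η/2) hε hε1 (by positivity)] with n hn hdiv
  have h1 := hn hdiv
  rw [Real.dist_eq, abs_lt]
  refine ⟨by linarith, ?_⟩
  have h2 : ∀ {α : Type} (S : Finset α) (P : α → Prop), pr S P ≤ 1 := by
    intro α S P
    unfold pr
    apply div_le_one_of_le₀ _ (Nat.cast_nonneg _)
    exact_mod_cast Finset.card_filter_le _ _
  have h3 := h2 ((Finset.univ : Finset (Picks (r+1+1) n ⌈ε ^ 2 * Real.log n⌉₊)) ×ˢ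
        (allEdges (r+1+1) n).powersetCard ⌊ε * n * Real.log n / ((r+1+1 : ℕ) * ρ)⌋₊)
      (fun ab => HasPerfectMatching (r+1+1) n (edgesOf ab.1 ∪ ab.2))
  linarith
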